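/- arXiv:math/0601124 — 2 statements merged into one kernel-verified Lean document; each statement's English description precedes it below -/
import Mathlib

section
/- (Equivalence of ensembles for ξ̄.) Let B ≥ 0. There exists a constant C = C(B) < ∞ with the following property. Let Λ be a cube of side length ℓ in ℤ^d, let α : Λ → [−B, B], let 0 < N < |Λ| and m = N/|Λ|, and set ξ_x = (1−η_x) e^{α_x} and ξ̄_Λ = Av_{x∈Λ} ξ_x. Let λ̂_Λ(m) be the empirical chemical potential, i.e. the unique real number with Av_{x∈Λ} e^{λ̂_Λ(m)+α_x}/(1+e^{λ̂_Λ(m)+α_x}) = m. Then | ⟨ξ̄_Λ⟩_{λ̂_Λ(m)} − E_{Λ,N}[ξ̄_Λ] | ≤ C ℓ^{-d}, where ⟨·⟩_{λ̂_Λ(m)} is the expectation with respect to the grand canonical measure with chemical potential λ̂_Λ(m) and E_{Λ,N} is the expectation with respect to the canonical measure with N particles. -/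
noncomputable section

/-- `η_x` as a real number, for a configuration given by its set of occupied sites. -/
def ind {V : Type*} [DecidableEq V] (S : Finset V) (x : V) : ℝ := if x ∈ S then 1 else 0

/-- Expectation with respect to the canonical measure on `{0,1}^Λ` with field `α` and `N`
particles: a configuration `S ⊆ Λ` with `|S| = N` has weight proportional to
`exp(∑_{x ∈ S} α_x)`. -/
def cE {V : Type*} [DecidableEq V] (Λ : Finset V) (α : V → ℝ) (N : ℕ)
    (g : Finset V → ℝ) : ℝ :=
  (∑ S ∈ Λ.powersetCard N, Real.exp (∑ x ∈ S, α x) * g S) /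
    ∑ S ∈ Λ.powersetCard N, Real.exp (∑ x ∈ S, α x)

/-- Expectation with respect to the grand canonical (product) measure on `{0,1}^Λ` under
which `η_x = 1` with probability `p x`, independently over `x ∈ Λ`. -/
def gcE {V : Type*} [DecidableEq V] (Λ : Finset V) (p : V → ℝ) (g : Finset V → ℝ) : ℝ :=
  ∑ S ∈ Λ.powerset, ((∏ x ∈ S, p x) * ∏ x ∈ Λ \ S, (1 - p x)) * g S

/-- The cube of side length `ℓ` in `ℤ^d` with corner `v`. -/
def cube (d : ℕ) (v : Fin d → ℤ) (ℓ : ℕ) : Finset (Fin d → ℤ) :=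
  Fintype.piFinset fun i => Finset.Ico (v i) (v i + ℓ)

/-- `ξ̄_Λ = Av_{x ∈ Λ} (1 - η_x) e^{α_x}`. -/
def xiBar {V : Type*} [DecidableEq V] (Λ : Finset V) (α : V → ℝ) (S : Finset V) : ℝ :=
  (Λ.card : ℝ)⁻¹ * ∑ x ∈ Λ, (1 - ind S x) * Real.exp (α x)

/-- The `k`-th elementary symmetric polynomial in the variables `a x`, `x ∈ s`. -/
def esym {V : Type*} (s : Finset V) (a : V → ℝ) (k : ℕ) : ℝ :=
  ∑ S ∈ s.powersetCard k, ∏ x ∈ S, a x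

section ElementarySymmetric

variable {V : Type*}

lemma esym_zero (s : Finset V) (a : V → ℝ) : esym s a 0 = 1 := by
  simp [esym]

lemma esym_nonneg {s : Finset V} {a : V → ℝ} (ha : ∀ x ∈ s, 0 < a x) (k : ℕ) :
    0 ≤ esym s a k :=
  Finset.sum_nonneg fun _ hS => Finset.prod_nonneg fun x hx =>
    (ha x ((Finset.mem_powersetCard.1 hS).1 hx)).le

lemma esym_pos {s : Finset V} {a : V → ℝ} (ha : ∀ x ∈ s, 0 < a x) {k : ℕ} (hk : k ≤ s.card) :
    0 < esym s a k :=
  Finset.sum_pos (fun _ hS => Finset.prod_pos fun x hx =>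
    ha x ((Finset.mem_powersetCard.1 hS).1 hx)) (Finset.powersetCard_nonempty.2 hk)

lemma esym_eq_zero (s : Finset V) (a : V → ℝ) {k : ℕ} (hk : s.card < k) : esym s a k = 0 := by
  simp [esym, Finset.powersetCard_eq_empty.2 hk]

variable [DecidableEq V]

lemma esym_insert_succ {s : Finset V} (a : V → ℝ) {x : V} (hx : x ∉ s) (k : ℕ) :
    esym (insert x s) a (k + 1) = esym s a (k + 1) + a x * esym s a k := by
  unfold esym
  rw [Finset.powersetCard_succ_insert hx, Finset.sum_union, Finset.sum_image, Finset.mul_sum]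
  · congr 1
    refine Finset.sum_congr rfl fun S hS => ?_
    rw [Finset.prod_insert fun h => hx ((Finset.mem_powersetCard.1 hS).1 h)]
  · intro S hS T hT h
    have hS' : x ∉ S := fun h => hx ((Finset.mem_powersetCard.1 hS).1 h)
    have hT' : x ∉ T := fun h => hx ((Finset.mem_powersetCard.1 hT).1 h)
    rw [← Finset.erase_insert hS', ← Finset.erase_insert hT', h]
  · refine Finset.disjoint_left.2 fun S hS hS' => ?_
    obtain ⟨T, -, rfl⟩ := Finset.mem_image.1 hS'
    exact hx ((Finset.mem_powersetCard.1 hS).1 (Finset.mem_insert_self x T))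

lemma esym_erase_succ {s : Finset V} (a : V → ℝ) {x : V} (hx : x ∈ s) (k : ℕ) :
    esym s a (k + 1) = esym (s.erase x) a (k + 1) + a x * esym (s.erase x) a k := by
  rw [← esym_insert_succ a (Finset.notMem_erase x s), Finset.insert_erase hx]

/-- Newton's inequality in the form that `k! * esym s a k` is log-concave in `k`. -/
lemma esym_newton {s : Finset V} {a : V → ℝ} (ha : ∀ x ∈ s, 0 < a x) (k : ℕ) :
    (k + 2 : ℝ) * (esym s a k * esym s a (k + 2)) ≤ (k + 1) * esym s a (k + 1) ^ 2 := by
  induction s using Finset.induction_on generalizing k with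
  | empty =>
    rw [esym_eq_zero ∅ a (by simp : (∅ : Finset V).card < k + 2), mul_zero, mul_zero]
    positivity
  | insert x s hx ih =>
    have hs : ∀ y ∈ s, 0 < a y := fun y hy => ha y (Finset.mem_insert_of_mem hy)
    have hax : 0 < a x := ha x (Finset.mem_insert_self x s)
    replace ih := ih hs
    cases k with
    | zero =>
      have h := ih 0
      rw [esym_insert_succ a hx, esym_insert_succ a hx]
      simp only [esym_zero, zero_add, CharP.cast_eq_zero] at h ⊢
      nlinarith [sq_nonneg (a x)]
    | succ k =>
      have h₁ := ih k
      have h₂ := ih (k + 1)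
      have h₃ : (k + 3 : ℝ) * (esym s a k * esym s a (k + 3)) ≤
          (k + 1) * (esym s a (k + 1) * esym s a (k + 2)) := by
        rcases lt_or_ge s.card (k + 3) with hc | hc
        · rw [esym_eq_zero s a hc, mul_zero, mul_zero]
          have := esym_nonneg hs (k + 1)
          have := esym_nonneg hs (k + 2)
          positivity
        · have p₀ := esym_pos hs (by omega : k ≤ s.card)
          have p₁ := esym_pos hs (by omega : k + 1 ≤ s.card)
          have p₂ := esym_pos hs (by omega : k + 2 ≤ s.card)
          have p₃ := esym_pos hs hc
          have h := mul_le_mul h₁ h₂ (by positivity) (by positivity)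
          push_cast at h
          have hq : 0 < (k + 2 : ℝ) * (esym s a (k + 1) * esym s a (k + 2)) := by positivity
          refine le_of_mul_le_mul_left ?_ hq
          refine le_trans (le_of_eq ?_) (h.trans (le_of_eq ?_)) <;> ring_nf
      rw [esym_insert_succ a hx, esym_insert_succ a hx, esym_insert_succ a hx]
      push_cast at h₂ ⊢
      have h₄ : (k + 3 : ℝ) * (esym s a k * esym s a (k + 2)) ≤ (k + 2) * esym s a (k + 1) ^ 2 := by
        have hk : (0 : ℝ) < k + 2 := by positivity
        refine le_of_mul_le_mul_left ?_ hk
        have := mul_le_mul_of_nonneg_left h₁ (by positivity : (0 : ℝ) ≤ k + 3)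
        nlinarith [sq_nonneg (esym s a (k + 1))]
      have h₅ := mul_le_mul_of_nonneg_left h₃ hax.le
      have h₆ := mul_le_mul_of_nonneg_left h₄ (sq_nonneg (a x))
      ring_nf at h₂ h₅ h₆ ⊢
      linarith

lemma esym_log_concave {s : Finset V} {a : V → ℝ} (ha : ∀ x ∈ s, 0 < a x) (k : ℕ) :
    esym s a k * esym s a (k + 2) ≤ esym s a (k + 1) ^ 2 := by
  have h := esym_newton ha k
  have h₀ := mul_nonneg (esym_nonneg ha k) (esym_nonneg ha (k + 2))
  have hk : (0 : ℝ) < k + 1 := by positivity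
  refine le_of_mul_le_mul_left ?_ hk
  linarith

lemma esym_erase_eq_sum {s : Finset V} (a : V → ℝ) (x : V) (k : ℕ) :
    esym (s.erase x) a k = ∑ S ∈ s.powersetCard k, (∏ y ∈ S, a y) * (1 - ind S x) := by
  have h : (s.erase x).powersetCard k = (s.powersetCard k).filter (fun S => x ∉ S) := by
    ext S
    simp only [Finset.mem_powersetCard, Finset.mem_filter, Finset.subset_erase]
    tauto
  rw [esym, h, Finset.sum_filter]
  refine Finset.sum_congr rfl fun S _ => ?_
  by_cases hx : x ∈ S <;> simp [ind, hx]

lemma sum_ind {s S : Finset V} (h : S ⊆ s) : ∑ x ∈ s, ind S x = S.card := by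
  simp [ind, Finset.inter_eq_right.2 h]

lemma sum_esym_erase (s : Finset V) (a : V → ℝ) (k : ℕ) :
    ∑ x ∈ s, esym (s.erase x) a k = (s.card - k) * esym s a k := by
  simp_rw [esym_erase_eq_sum]
  rw [Finset.sum_comm, esym, Finset.mul_sum]
  refine Finset.sum_congr rfl fun S hS => ?_
  obtain ⟨hS, hc⟩ := Finset.mem_powersetCard.1 hS
  rw [← Finset.mul_sum, Finset.sum_sub_distrib, sum_ind hS, hc]
  simp [mul_comm]

lemma sum_mul_esym_erase (s : Finset V) (a : V → ℝ) (k : ℕ) :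
    ∑ x ∈ s, a x * esym (s.erase x) a k = (k + 1) * esym s a (k + 1) := by
  have h : ∀ x ∈ s, a x * esym (s.erase x) a k
      = esym s a (k + 1) - esym (s.erase x) a (k + 1) := fun x hx => by
    rw [esym_erase_succ a hx]; ring
  rw [Finset.sum_congr rfl h, Finset.sum_sub_distrib, sum_esym_erase]
  simp only [Finset.sum_const, nsmul_eq_mul, Nat.cast_add, Nat.cast_one]
  ring

lemma esym_erase_le {s : Finset V} {a : V → ℝ} (ha : ∀ x ∈ s, 0 < a x) (x : V) (k : ℕ) :
    esym (s.erase x) a k ≤ esym s a k :=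
  Finset.sum_le_sum_of_subset_of_nonneg (Finset.powersetCard_mono (Finset.erase_subset x s))
    fun _ hS _ => Finset.prod_nonneg fun y hy =>
      (ha y ((Finset.mem_powersetCard.1 hS).1 hy)).le

lemma esym_mul_esym_erase_le {s : Finset V} {a : V → ℝ} (ha : ∀ x ∈ s, 0 < a x) {x : V}
    (hx : x ∈ s) (k : ℕ) :
    esym s a k * esym (s.erase x) a (k + 1) ≤ esym (s.erase x) a k * esym s a (k + 1) := by
  have he : ∀ y ∈ s.erase x, 0 < a y := fun y hy => ha y (Finset.mem_of_mem_erase hy)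
  cases k with
  | zero =>
    rw [esym_zero, esym_zero, one_mul, one_mul]
    exact esym_erase_le ha x 1
  | succ k =>
    rw [esym_erase_succ a hx k, esym_erase_succ a hx (k + 1)]
    have := mul_le_mul_of_nonneg_left (esym_log_concave he k) (ha x hx).le
    linarith

/-- Comparison of two fugacities through the total density they produce: `z` produces mean
particle number `k + 1`, as does the family of ratios `esym (s.erase x) a k / esym (s.erase x) a (k + 1)`,
so `z` cannot lie strictly on one side of all these ratios. -/
lemma exists_fugacity_le {s : Finset V} {a : V → ℝ} (ha : ∀ x ∈ s, 0 < a x) {k : ℕ}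
    (hk : k + 1 < s.card) {z : ℝ} (hz : 0 < z)
    (hsum : ∑ x ∈ s, z * a x / (1 + z * a x) = k + 1) :
    (∃ x ∈ s, esym (s.erase x) a k ≤ z * esym (s.erase x) a (k + 1)) ∧
      ∃ x ∈ s, z * esym (s.erase x) a (k + 1) ≤ esym (s.erase x) a k := by
  have hE : 0 < esym s a (k + 1) := esym_pos ha hk.le
  have hne : s.Nonempty := Finset.card_pos.1 (by omega)
  have hcan : ∑ x ∈ s, a x * esym (s.erase x) a k / esym s a (k + 1) = k + 1 := by
    rw [← Finset.sum_div, sum_mul_esym_erase, mul_div_cancel_right₀ _ hE.ne']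
  constructor
  · obtain ⟨x, hx, h⟩ := Finset.exists_le_of_sum_le hne (hcan.trans hsum.symm).le
    refine ⟨x, hx, ?_⟩
    have hax := ha x hx
    rw [div_le_div_iff₀ hE (by positivity), esym_erase_succ a hx] at h
    refine le_of_mul_le_mul_left ?_ hax
    linarith
  · obtain ⟨x, hx, h⟩ := Finset.exists_le_of_sum_le hne (hsum.trans hcan.symm).le
    refine ⟨x, hx, ?_⟩
    have hax := ha x hx
    rw [div_le_div_iff₀ (by positivity) hE, esym_erase_succ a hx] at h
    refine le_of_mul_le_mul_left ?_ hax
    linarith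

lemma abs_fugacity_sub_le {s : Finset V} {a : V → ℝ} (ha : ∀ x ∈ s, 0 < a x) {M : ℝ}
    (haM : ∀ x ∈ s, a x ≤ M) {k : ℕ} (hk : k + 1 < s.card) {z : ℝ} (hz : 0 < z)
    (hsum : ∑ x ∈ s, z * a x / (1 + z * a x) = k + 1) :
    |(k + 1) / z - (k + 2) * esym s a (k + 2) / esym s a (k + 1)| ≤ M := by
  have e₀ : 0 < esym s a k := esym_pos ha (by omega)
  have e₁ : 0 < esym s a (k + 1) := esym_pos ha hk.le
  have hA : ∀ x ∈ s, 0 < esym (s.erase x) a (k + 1) := fun x hx =>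
    esym_pos (fun y hy => ha y (Finset.mem_of_mem_erase hy))
      (by rw [Finset.card_erase_of_mem hx]; omega)
  obtain ⟨⟨x, hx, hxz⟩, ⟨y, hy, hyz⟩⟩ := exists_fugacity_le ha hk hz hsum
  have lower : esym s a k ≤ z * esym s a (k + 1) := by
    have h := esym_mul_esym_erase_le ha hx k
    have h' := mul_le_mul_of_nonneg_right hxz e₁.le
    refine le_of_mul_le_mul_right ?_ (hA x hx)
    linarith
  have upper : (k + 2) * z * esym s a (k + 2) ≤ (k + 1) * esym s a (k + 1) + M * esym s a k := by
    have he : ∀ w ∈ s.erase y, 0 < a w := fun w hw => ha w (Finset.mem_of_mem_erase hw)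
    have hn := esym_newton he k
    have e₂ : 0 ≤ esym s a (k + 2) := esym_nonneg ha _
    have h₁ := mul_le_mul_of_nonneg_right hyz (by positivity : 0 ≤ (k + 2 : ℝ) * esym s a (k + 2))
    have h₂ : a y * esym (s.erase y) a k ≤ M * esym s a k :=
      mul_le_mul (haM y hy) (esym_erase_le ha y k) (esym_nonneg he k)
        ((ha y hy).le.trans (haM y hy))
    have h₃ := mul_le_mul_of_nonneg_right h₂ (hA y hy).le
    refine le_of_mul_le_mul_right ?_ (hA y hy)
    rw [esym_erase_succ a hy k]
    rw [esym_erase_succ a hy (k + 1)] at h₁ ⊢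
    linarith
  have decrease : (k + 1) * esym s a (k + 1) / esym s a k
      - (k + 2) * esym s a (k + 2) / esym s a (k + 1) ≤ M := by
    have h₀ := sum_mul_esym_erase s a k
    have h₁ := sum_mul_esym_erase s a (k + 1)
    push_cast at h₁
    rw [show (k + 2 : ℝ) = k + 1 + 1 by ring, ← h₀, ← h₁, Finset.sum_div, Finset.sum_div,
      ← Finset.sum_sub_distrib]
    have hle : ∀ x ∈ s, a x * esym (s.erase x) a k / esym s a k
        - a x * esym (s.erase x) a (k + 1) / esym s a (k + 1)
        ≤ M * (esym (s.erase x) a k / esym s a k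
          - esym (s.erase x) a (k + 1) / esym s a (k + 1)) := fun x hx => by
      rw [mul_div_assoc, mul_div_assoc, ← mul_sub]
      refine mul_le_mul_of_nonneg_right (haM x hx) (sub_nonneg.2 ?_)
      rw [div_le_div_iff₀ e₁ e₀, mul_comm]
      exact esym_mul_esym_erase_le ha hx k
    refine (Finset.sum_le_sum hle).trans (le_of_eq ?_)
    rw [← Finset.mul_sum, Finset.sum_sub_distrib, ← Finset.sum_div, ← Finset.sum_div,
      sum_esym_erase, sum_esym_erase, mul_div_cancel_right₀ _ e₀.ne',
      mul_div_cancel_right₀ _ e₁.ne']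
    push_cast
    ring
  have hM : 0 ≤ M := (ha x hx).le.trans (haM x hx)
  rw [abs_le]
  constructor
  · have : (k + 2) * esym s a (k + 2) / esym s a (k + 1) ≤ (k + 1) / z + M := by
      rw [div_add' _ _ _ hz.ne', div_le_div_iff₀ e₁ hz]
      have := mul_le_mul_of_nonneg_left lower hM
      linarith
    linarith
  · have : (k + 1) / z ≤ (k + 1) * esym s a (k + 1) / esym s a k := by
      rw [div_le_div_iff₀ hz e₀]
      have := mul_le_mul_of_nonneg_left lower (by positivity : (0 : ℝ) ≤ k + 1)
      linarith
    linarith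

end ElementarySymmetric

section Ensembles

variable {V : Type*} [DecidableEq V]

lemma sum_prod_mul_one_sub_ind (Λ : Finset V) (p : V → ℝ) {x : V} (hx : x ∈ Λ) :
    ∑ S ∈ Λ.powerset, ((∏ y ∈ S, p y) * ∏ y ∈ Λ \ S, (1 - p y)) * (1 - ind S x) = 1 - p x := by
  have h := Finset.prod_add (Function.update p x 0) (fun y => 1 - p y) Λ
  have hprod : ∏ y ∈ Λ, (Function.update p x 0 y + (1 - p y)) = 1 - p x := by
    rw [Finset.prod_eq_single_of_mem x hx]
    · simp
    · intro y _ hy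
      simp [Function.update_of_ne hy]
  rw [← hprod, h]
  refine Finset.sum_congr rfl fun S _ => ?_
  by_cases hxS : x ∈ S
  · rw [Finset.prod_eq_zero (f := Function.update p x 0) hxS (by simp)]
    simp [ind, hxS]
  · rw [Finset.prod_congr rfl fun y hy =>
      Function.update_of_ne (ne_of_mem_of_not_mem hy hxS) (0 : ℝ) p]
    simp [ind, hxS]

lemma gcE_xiBar (Λ : Finset V) (p α : V → ℝ) :
    gcE Λ p (xiBar Λ α) = (Λ.card : ℝ)⁻¹ * ∑ x ∈ Λ, (1 - p x) * Real.exp (α x) := by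
  simp_rw [gcE, xiBar, Finset.mul_sum]
  rw [Finset.sum_comm]
  refine Finset.sum_congr rfl fun x hx => ?_
  rw [← sum_prod_mul_one_sub_ind Λ p hx, Finset.sum_mul, Finset.mul_sum]
  exact Finset.sum_congr rfl fun S _ => by ring

lemma cE_xiBar (Λ : Finset V) (α : V → ℝ) (N : ℕ) :
    cE Λ α N (xiBar Λ α) = (Λ.card : ℝ)⁻¹ *
      ((N + 1) * esym Λ (fun x => Real.exp (α x)) (N + 1)
        / esym Λ (fun x => Real.exp (α x)) N) := by
  rw [← sum_mul_esym_erase, ← mul_div_assoc]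
  simp_rw [cE, Real.exp_sum]
  congr 1
  simp_rw [esym_erase_eq_sum, xiBar, Finset.mul_sum]
  rw [Finset.sum_comm]
  exact Finset.sum_congr rfl fun x _ => Finset.sum_congr rfl fun S _ => by ring

lemma card_cube (d : ℕ) (v : Fin d → ℤ) (ℓ : ℕ) : (cube d v ℓ).card = ℓ ^ d := by
  simp [cube]

/-- Equivalence of ensembles for `ξ̄` on an arbitrary finite set. -/
lemma abs_gcE_sub_cE_xiBar_le {Λ : Finset V} {α : V → ℝ} {B : ℝ} (hα : ∀ x ∈ Λ, |α x| ≤ B)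
    {N : ℕ} (hN : 0 < N) (hN' : N < Λ.card) {lam : ℝ}
    (hlam : ∑ x ∈ Λ, Real.exp (lam + α x) / (1 + Real.exp (lam + α x)) = N) :
    |gcE Λ (fun x => Real.exp (α x + lam) / (1 + Real.exp (α x + lam))) (xiBar Λ α)
      - cE Λ α N (xiBar Λ α)| ≤ Real.exp B / Λ.card := by
  obtain ⟨k, rfl⟩ := Nat.exists_eq_succ_of_ne_zero hN.ne'
  have hz := Real.exp_pos lam
  have hgc : ∑ x ∈ Λ, (1 - Real.exp (α x + lam) / (1 + Real.exp (α x + lam))) * Real.exp (α x)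
      = (k + 1) / Real.exp lam := by
    push_cast at hlam
    rw [← hlam, Finset.sum_div]
    refine Finset.sum_congr rfl fun x _ => ?_
    rw [add_comm (α x), Real.exp_add]
    have := Real.exp_pos (α x)
    field_simp
    ring
  simp_rw [Real.exp_add] at hlam
  push_cast at hlam
  have h := abs_fugacity_sub_le (s := Λ) (a := fun x => Real.exp (α x))
    (fun x _ => Real.exp_pos _) (M := Real.exp B)
    (fun x hx => Real.exp_le_exp.2 ((le_abs_self _).trans (hα x hx))) hN' hz hlam
  rw [gcE_xiBar, cE_xiBar, hgc, ← mul_sub, abs_mul,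
    abs_of_nonneg (inv_nonneg.2 (Nat.cast_nonneg _)), div_eq_inv_mul (Real.exp B)]
  refine mul_le_mul_of_nonneg_left ?_ (by positivity)
  push_cast
  rwa [add_assoc (k : ℝ), one_add_one_eq_two]

end Ensembles

theorem stmt_10 (d : ℕ) (B : ℝ) (hB : 0 ≤ B) :
    ∃ C : ℝ, ∀ (ℓ : ℕ) (v : Fin d → ℤ) (α : (Fin d → ℤ) → ℝ),
      (∀ x ∈ cube d v ℓ, |α x| ≤ B) →
      ∀ N : ℕ, 0 < N → N < (cube d v ℓ).card →
      ∀ lamhat : ℝ,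
        ((cube d v ℓ).card : ℝ)⁻¹ * (∑ x ∈ cube d v ℓ,
            Real.exp (lamhat + α x) / (1 + Real.exp (lamhat + α x)))
          = (N : ℝ) / ((cube d v ℓ).card : ℝ) →
        |gcE (cube d v ℓ)
            (fun x => Real.exp (α x + lamhat) / (1 + Real.exp (α x + lamhat)))
            (xiBar (cube d v ℓ) α)
          - cE (cube d v ℓ) α N (xiBar (cube d v ℓ) α)| ≤ C / (ℓ : ℝ) ^ d := by
  refine ⟨Real.exp B, fun ℓ v α hα N hN hN' lamhat hlam => ?_⟩
  have hc : ((cube d v ℓ).card : ℝ) ≠ 0 := by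
    exact_mod_cast (hN.trans hN').ne'
  rw [div_eq_inv_mul] at hlam
  have h := abs_gcE_sub_cE_xiBar_le hα hN hN' (mul_left_cancel₀ (inv_ne_zero hc) hlam)
  have hcard : ((cube d v ℓ).card : ℝ) = (ℓ : ℝ) ^ d := by
    exact_mod_cast card_cube d v ℓ
  rwa [← hcard]
end
end

section
/- (Uniqueness of weak solutions.) Let T > 0, d ≥ 1, c > 0 and C < ∞. Let D : [0,1] → (symmetric d×d real matrices) be measurable and satisfy c|ξ|² ≤ ξ·D(u)ξ ≤ c^{-1}|ξ|² for all u ∈ [0,1] and ξ ∈ ℝ^d, together with the regularity condition |D(x) − D(y)|² ≤ C (x(1−x))^{-1} |x − y| for all x ∈ (0,1) and y ∈ [0,1]. Call a pair (u, g) a weak solution of ∂_t u = ∇·D(u)∇u on [0,T] × 𝕋^d if: u : [0,T] × 𝕋^d → [0,1] is measurable and weakly continuous in time, g ∈ L²([0,T] × 𝕋^d; ℝ^d) is the weak spatial gradient of u (i.e. ∫₀^T ∫_{𝕋^d} u ∇·Φ dθ dt = −∫₀^T ∫_{𝕋^d} g·Φ dθ dt for every smooth vector field Φ on [0,T] ×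 𝕋^d), the energy condition ∫₀^T ∫_{𝕋^d} |g|²/(u(1−u)) dθ dt < ∞ holds, and for every smooth function φ on [0,T] × 𝕋^d: ∫_{𝕋^d} φ(T)u(T) dθ − ∫_{𝕋^d} φ(0)u(0) dθ = ∫₀^T ∫_{𝕋^d} (∂φ/∂t) u dθ dt − ∫₀^T ∫_{𝕋^d} ∇φ · D(u) g dθ dt. Then any two weak solutions (u₁, g₁) and (u₂, g₂) with the same initial data u₁(0,·) = u₂(0,·) a.e. satisfy u₁ = u₂ almost everywhere on [0,T] × 𝕋^d. -/
noncomputable section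
open MeasureTheory Matrix

/-- The fundamental domain `[0,1)^d` of the torus `𝕋^d = ℝ^d/ℤ^d`. -/
def cubeR (d : ℕ) : Set (Fin d → ℝ) := Set.univ.pi fun _ => Set.Ico (0 : ℝ) 1

/-- The space-time domain `(0,T] × 𝕋^d`. -/
def QT (d : ℕ) (T : ℝ) : Set (ℝ × (Fin d → ℝ)) := Set.Ioc 0 T ×ˢ cubeR d

/-- `(u, g)` is a weak solution of `∂_t u = ∇·D(u)∇u` on `[0,T] × 𝕋^d`:
`u` takes values in `[0,1]`, is `ℤ^d`-periodic in space, weakly continuous in time;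
`g ∈ L²` is the weak spatial gradient of `u`; the energy condition
`∫∫ |g|²/(u(1-u)) < ∞` holds; and the weak formulation of the equation holds for all
smooth space-periodic test functions. -/
def IsWeakSolution (d : ℕ) (T : ℝ) (D : ℝ → Matrix (Fin d) (Fin d) ℝ)
    (u : ℝ → (Fin d → ℝ) → ℝ) (g : ℝ → (Fin d → ℝ) → Fin d → ℝ) : Prop :=
  Measurable (fun p : ℝ × (Fin d → ℝ) => u p.1 p.2) ∧
  (∀ t θ, u t θ ∈ Set.Icc (0 : ℝ) 1) ∧
  (∀ t θ i, u t (Function.update θ i (θ i + 1)) = u t θ) ∧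
  -- weak continuity in time
  (∀ φ : (Fin d → ℝ) → ℝ, ContDiff ℝ (⊤ : ℕ∞) φ →
    (∀ θ i, φ (Function.update θ i (θ i + 1)) = φ θ) →
    Continuous fun t => ∫ θ in cubeR d, φ θ * u t θ) ∧
  Measurable (fun p : ℝ × (Fin d → ℝ) => g p.1 p.2) ∧
  -- g ∈ L²([0,T] × 𝕋^d)
  IntegrableOn (fun p : ℝ × (Fin d → ℝ) => ∑ i, (g p.1 p.2 i) ^ 2) (QT d T) volume ∧
  -- g is the weak spatial gradient of u
  (∀ Φ : ℝ × (Fin d → ℝ) → Fin d → ℝ, ContDiff ℝ (⊤ : ℕ∞) Φ →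
    (∀ t θ i j, Φ (t, Function.update θ i (θ i + 1)) j = Φ (t, θ) j) →
    (∫ p in QT d T, u p.1 p.2 *
        ∑ i, fderiv ℝ (fun θ => Φ (p.1, θ) i) p.2 (Pi.single i 1))
      = -∫ p in QT d T, ∑ i, g p.1 p.2 i * Φ p i) ∧
  -- the energy condition
  IntegrableOn (fun p : ℝ × (Fin d → ℝ) =>
    (∑ i, (g p.1 p.2 i) ^ 2) / (u p.1 p.2 * (1 - u p.1 p.2))) (QT d T) volume ∧
  -- the weak formulation of the equation
  (∀ φ : ℝ × (Fin d → ℝ) → ℝ, ContDiff ℝ (⊤ : ℕ∞) φ →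
    (∀ t θ i, φ (t, Function.update θ i (θ i + 1)) = φ (t, θ)) →
    ((∫ θ in cubeR d, φ (T, θ) * u T θ) - ∫ θ in cubeR d, φ (0, θ) * u 0 θ)
      = (∫ p in QT d T, deriv (fun s => φ (s, p.2)) p.1 * u p.1 p.2)
        - ∫ p in QT d T, ∑ i, ∑ j,
            fderiv ℝ (fun θ => φ (p.1, θ)) p.2 (Pi.single i 1) * D (u p.1 p.2) i j
              * g p.1 p.2 j)

open Set Filter Topology
open scoped ContDiff

/-- A function on `ℝ^d` that is `ℤ^d`-periodic. -/
def SpacePeriodic {d : ℕ} {α : Type*} (f : (Fin d → ℝ) → α) : Prop :=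
  ∀ θ i, f (Function.update θ i (θ i + 1)) = f θ

/-- Smooth nonnegative periodic kernels of unit mass. -/
structure IsPeriodicMollifier {d : ℕ} (k : (Fin d → ℝ) → ℝ) : Prop where
  contDiff : ContDiff ℝ ∞ k
  nonneg : ∀ z, 0 ≤ k z
  periodic : SpacePeriodic k
  integral_left : ∀ θ, ∫ θ' in cubeR d, k (θ - θ') = 1
  integral_right : ∀ η, ∫ θ in cubeR d, k (θ - η) = 1

/-- The periodic convolution of `k` with the restriction of `f` to the fundamental domain. -/
def torusConv {d : ℕ} (k f : (Fin d → ℝ) → ℝ) (θ : Fin d → ℝ) : ℝ :=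
  ∫ θ' in cubeR d, k (θ - θ') * f θ'

section Cube

lemma measurableSet_cubeR (d : ℕ) : MeasurableSet (cubeR d) :=
  MeasurableSet.univ_pi fun _ => measurableSet_Ico

lemma cubeR_ae_eq_Icc (d : ℕ) : cubeR d =ᵐ[volume] Icc (0 : Fin d → ℝ) 1 := by
  have := Measure.univ_pi_Ico_ae_eq_Icc (μ := fun _ : Fin d => (volume : Measure ℝ))
    (f := (0 : Fin d → ℝ)) (g := 1)
  simpa [cubeR, volume_pi] using this

lemma restrict_cubeR_eq_restrict_Icc (d : ℕ) :
    (volume.restrict (cubeR d) : Measure (Fin d → ℝ)) = volume.restrict (Icc 0 1) :=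
  Measure.restrict_congr_set (cubeR_ae_eq_Icc d)

lemma restrict_cubeR_eq_pi (d : ℕ) : (volume.restrict (cubeR d) : Measure (Fin d → ℝ)) =
    Measure.pi fun _ => volume.restrict (Ico (0 : ℝ) 1) := by
  rw [cubeR, volume_pi, Measure.restrict_pi_pi]

instance isProbabilityMeasure_cubeR (d : ℕ) :
    IsProbabilityMeasure (volume.restrict (cubeR d) : Measure (Fin d → ℝ)) := by
  refine ⟨?_⟩
  rw [restrict_cubeR_eq_pi]
  simp [Measure.pi_univ]

lemma interior_Icc_zero_one_pi (d : ℕ) :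
    interior (Icc (0 : Fin d → ℝ) 1) = univ.pi fun _ => Ioo (0 : ℝ) 1 := by
  rw [← pi_univ_Icc, interior_pi_set finite_univ]
  simp

lemma ae_mem_interior_cubeR (d : ℕ) :
    ∀ᵐ θ ∂(volume.restrict (cubeR d) : Measure (Fin d → ℝ)),
      θ ∈ interior (Icc (0 : Fin d → ℝ) 1) := by
  rw [restrict_cubeR_eq_restrict_Icc, interior_Icc_zero_one_pi]
  have h : (univ.pi fun _ => Ioo (0 : ℝ) 1) =ᵐ[volume] Icc (0 : Fin d → ℝ) 1 := by
    have := Measure.univ_pi_Ioo_ae_eq_Icc (μ := fun _ : Fin d => (volume : Measure ℝ))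
      (f := (0 : Fin d → ℝ)) (g := 1)
    simpa [volume_pi] using this
  rw [← Measure.restrict_congr_set h]
  exact ae_restrict_mem (MeasurableSet.univ_pi fun _ => measurableSet_Ioo)

lemma integral_cubeR_prod_eq_pow (d : ℕ) (f : Fin d → ℝ → ℝ) :
    ∫ x in cubeR d, ∏ i, f i (x i) = ∏ i, ∫ x in (0 : ℝ)..1, f i x := by
  rw [restrict_cubeR_eq_pi, integral_fintype_prod_eq_prod]
  refine Finset.prod_congr rfl fun i _ => ?_
  rw [intervalIntegral.integral_of_le zero_le_one, integral_Ico_eq_integral_Ioo,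
    integral_Ioc_eq_integral_Ioo]

lemma Continuous.integrable_cubeR {d : ℕ} {E : Type*} [NormedAddCommGroup E]
    {f : (Fin d → ℝ) → E} (hf : Continuous f) :
    Integrable f (volume.restrict (cubeR d)) := by
  rw [restrict_cubeR_eq_restrict_Icc]
  exact hf.continuousOn.integrableOn_compact isCompact_Icc

end Cube

section Kernel

/-- `∏ᵢ (1 + cos (2π zᵢ))`, which is maximal exactly on `ℤ^d`. -/
def cosBump (d : ℕ) (z : Fin d → ℝ) : ℝ := ∏ i, (1 + Real.cos (2 * Real.pi * z i))

/-- The normalized `n`-th power of `cosBump`, an approximate identity on the torus. -/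
def cosKernel (d n : ℕ) (z : Fin d → ℝ) : ℝ :=
  (∫ x in cubeR d, cosBump d x ^ n)⁻¹ * cosBump d z ^ n

lemma contDiff_cosBump (d : ℕ) : ContDiff ℝ ∞ (cosBump d) := by
  unfold cosBump
  fun_prop

lemma cosBump_nonneg (d : ℕ) (z : Fin d → ℝ) : 0 ≤ cosBump d z :=
  Finset.prod_nonneg fun i _ => by linarith [Real.neg_one_le_cos (2 * Real.pi * z i)]

lemma spacePeriodic_cosBump (d : ℕ) : SpacePeriodic (cosBump d) := by
  intro z i
  refine Finset.prod_congr rfl fun j _ => ?_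
  by_cases h : j = i
  · subst h
    rw [Function.update_self, mul_add, mul_one, Real.cos_add_two_pi]
  · rw [Function.update_of_ne h]

lemma cosBump_sub_comm (d : ℕ) (x y : Fin d → ℝ) : cosBump d (x - y) = cosBump d (y - x) := by
  refine Finset.prod_congr rfl fun j _ => ?_
  rw [← Real.cos_neg]
  congr 2
  simp only [Pi.sub_apply]
  ring

lemma integral_one_add_cos_pow_sub (n : ℕ) (a : ℝ) :
    ∫ x in (0 : ℝ)..1, (1 + Real.cos (2 * Real.pi * (x - a))) ^ n =
      ∫ x in (0 : ℝ)..1, (1 + Real.cos (2 * Real.pi * x)) ^ n := by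
  have hp : Function.Periodic (fun x : ℝ => (1 + Real.cos (2 * Real.pi * x)) ^ n) 1 := by
    intro x
    simp only [mul_add, mul_one, Real.cos_add_two_pi]
  rw [intervalIntegral.integral_comp_sub_right
    (fun x => (1 + Real.cos (2 * Real.pi * x)) ^ n) a]
  have := hp.intervalIntegral_add_eq (0 - a) 0
  rw [zero_add] at this
  rw [← this]
  congr 1
  ring

lemma integral_cosBump_pow_sub (d n : ℕ) (a : Fin d → ℝ) :
    ∫ x in cubeR d, cosBump d (x - a) ^ n = ∫ x in cubeR d, cosBump d x ^ n := by
  have h : ∀ b : Fin d → ℝ, ∫ x in cubeR d, cosBump d (x - b) ^ n =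
      ∏ i, ∫ x in (0 : ℝ)..1, (1 + Real.cos (2 * Real.pi * (x - b i))) ^ n := by
    intro b
    rw [← integral_cubeR_prod_eq_pow]
    refine integral_congr_ae (.of_forall fun x => ?_)
    simp only [cosBump, Pi.sub_apply, Finset.prod_pow]
  have h0 := h 0
  rw [h a]
  simp only [sub_zero, Pi.zero_apply] at h0
  rw [h0]
  exact Finset.prod_congr rfl fun i _ => integral_one_add_cos_pow_sub n (a i)

lemma integral_cosBump_pow_pos (d n : ℕ) : 0 < ∫ x in cubeR d, cosBump d x ^ n := by
  have h : ∫ x in cubeR d, cosBump d x ^ n =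
      ∏ i : Fin d, ∫ x in (0 : ℝ)..1, (1 + Real.cos (2 * Real.pi * x)) ^ n := by
    rw [← integral_cubeR_prod_eq_pow]
    refine integral_congr_ae (.of_forall fun x => ?_)
    simp only [cosBump, Finset.prod_pow]
  rw [h]
  refine Finset.prod_pos fun i _ => ?_
  refine intervalIntegral.integral_pos zero_lt_one (by fun_prop) ?_ ⟨0, by simp, by simp⟩
  intro x _
  have := Real.neg_one_le_cos (2 * Real.pi * x)
  exact pow_nonneg (by linarith) n

lemma isPeriodicMollifier_cosKernel (d n : ℕ) : IsPeriodicMollifier (cosKernel d n) where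
  contDiff := contDiff_const.mul ((contDiff_cosBump d).pow n)
  nonneg z := mul_nonneg (inv_nonneg.2 (integral_cosBump_pow_pos d n).le)
    (pow_nonneg (cosBump_nonneg d z) n)
  periodic θ i := by simp only [cosKernel, spacePeriodic_cosBump d θ i]
  integral_left θ := by
    simp only [cosKernel, cosBump_sub_comm d θ]
    rw [integral_const_mul, integral_cosBump_pow_sub,
      inv_mul_cancel₀ (integral_cosBump_pow_pos d n).ne']
  integral_right θ := by
    simp only [cosKernel]
    rw [integral_const_mul, integral_cosBump_pow_sub,
      inv_mul_cancel₀ (integral_cosBump_pow_pos d n).ne']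

lemma cosBump_lt_of_ne {d : ℕ} {x y : Fin d → ℝ} (hx : x ∈ interior (Icc (0 : Fin d → ℝ) 1))
    (hy : y ∈ Icc (0 : Fin d → ℝ) 1) (h : y ≠ x) : cosBump d (x - y) < cosBump d (x - x) := by
  rw [interior_Icc_zero_one_pi] at hx
  obtain ⟨i, hi⟩ := Function.ne_iff.1 h
  have hle : ∀ t : ℝ, 1 + Real.cos t ≤ 2 := fun t => by linarith [Real.cos_le_one t]
  have hge : ∀ t : ℝ, 0 ≤ 1 + Real.cos t := fun t => by linarith [Real.neg_one_le_cos t]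
  have hlt : 1 + Real.cos (2 * Real.pi * (x i - y i)) < 2 := by
    have hx' := hx i (mem_univ i)
    have h1 := hy.1 i
    have h2 := hy.2 i
    simp only [Pi.zero_apply, Pi.one_apply, mem_Ioo] at h1 h2 hx'
    refine lt_of_le_of_ne (hle _) fun heq => ?_
    have hc : Real.cos (2 * Real.pi * (x i - y i)) = 1 := by linarith
    have hpi := Real.pi_pos
    have := (Real.cos_eq_one_iff_of_lt_of_lt (x := 2 * Real.pi * (x i - y i))
      (by nlinarith) (by nlinarith)).1 hc
    rcases mul_eq_zero.1 this with h0 | h0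
    · linarith
    · exact hi (by linarith)
  simp only [cosBump, Pi.sub_apply, sub_self, mul_zero, Real.cos_zero]
  rw [← Finset.mul_prod_erase _ _ (Finset.mem_univ i),
    ← Finset.mul_prod_erase _ (fun _ => (1 : ℝ) + 1) (Finset.mem_univ i)]
  have hA : ∏ j ∈ Finset.univ.erase i, (1 + Real.cos (2 * Real.pi * (x j - y j))) ≤
      ∏ j ∈ Finset.univ.erase i, ((1 : ℝ) + 1) :=
    Finset.prod_le_prod (fun j _ => hge _) fun j _ => by linarith [hle (2 * Real.pi * (x j - y j))]
  have hB : 0 < ∏ j ∈ Finset.univ.erase i, ((1 : ℝ) + 1) := Finset.prod_pos fun _ _ => by norm_num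
  nlinarith [hge (2 * Real.pi * (x i - y i))]

lemma tendsto_torusConv_cosKernel {d : ℕ} {f : (Fin d → ℝ) → ℝ} (hf : Continuous f)
    {θ : Fin d → ℝ} (hθ : θ ∈ interior (Icc (0 : Fin d → ℝ) 1)) :
    Tendsto (fun n => torusConv (cosKernel d n) f θ) atTop (𝓝 (f θ)) := by
  have hc : Continuous (cosBump d) := (contDiff_cosBump d).continuous
  have h := tendsto_setIntegral_pow_smul_of_unique_maximum_of_isCompact_of_continuousOn
    (μ := (volume : Measure (Fin d → ℝ))) (s := Icc 0 1) (x₀ := θ)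
    (c := fun y => cosBump d (θ - y)) (g := f) isCompact_Icc (by fun_prop)
    (fun y hy hne => cosBump_lt_of_ne hθ hy hne) (fun y _ => cosBump_nonneg d _)
    (by simp [cosBump]) (subset_closure hθ) hf.continuousOn
  refine h.congr fun n => ?_
  rw [← restrict_cubeR_eq_restrict_Icc]
  simp only [torusConv, cosKernel, smul_eq_mul, mul_assoc]
  rw [integral_const_mul]
  simp only [cosBump_sub_comm d θ]
  rw [integral_cosBump_pow_sub]

end Kernel

section Convolution

variable {d : ℕ} {k : (Fin d → ℝ) → ℝ}

lemma lintegral_enorm_sq_eq_eLpNorm {α : Type*} [MeasurableSpace α] (μ : Measure α)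
    (f : α → ℝ) : ∫⁻ x, ‖f x‖ₑ ^ 2 ∂μ = eLpNorm f 2 μ ^ 2 := by
  have := eLpNorm_nnreal_pow_eq_lintegral (f := f) (μ := μ) (p := 2) two_ne_zero
  simpa using this.symm

/-- Jensen's inequality for the square, with respect to a probability density `k`. -/
lemma enorm_integral_mul_sq_le {α : Type*} [MeasurableSpace α] {μ : Measure α} {k f : α → ℝ}
    (hk : Measurable k) (hk0 : ∀ x, 0 ≤ k x) (hki : Integrable k μ) (hk1 : ∫ x, k x ∂μ = 1)
    (hf : Measurable f) :
    ‖∫ x, k x * f x ∂μ‖ₑ ^ 2 ≤ ∫⁻ x, ENNReal.ofReal (k x) * ‖f x‖ₑ ^ 2 ∂μ := by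
  have hk' : Measurable fun x => ENNReal.ofReal (k x) := hk.ennreal_ofReal
  let ρ := μ.withDensity fun x => ENNReal.ofReal (k x)
  have hρ : IsProbabilityMeasure ρ := by
    refine ⟨?_⟩
    rw [withDensity_apply _ MeasurableSet.univ, Measure.restrict_univ,
      ← ofReal_integral_eq_lintegral_ofReal hki (.of_forall hk0), hk1, ENNReal.ofReal_one]
  have h1 : ‖∫ x, k x * f x ∂μ‖ₑ ≤ eLpNorm f 1 ρ := by
    refine (enorm_integral_le_lintegral_enorm _).trans (le_of_eq ?_)
    rw [eLpNorm_one_eq_lintegral_enorm, lintegral_withDensity_eq_lintegral_mul _ hk' hf.enorm]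
    refine lintegral_congr fun x => ?_
    simp [enorm_mul, Real.enorm_of_nonneg (hk0 x)]
  have h2 : eLpNorm f 1 ρ ≤ eLpNorm f 2 ρ :=
    eLpNorm_le_eLpNorm_of_exponent_le one_le_two hf.aestronglyMeasurable
  calc ‖∫ x, k x * f x ∂μ‖ₑ ^ 2 ≤ eLpNorm f 2 ρ ^ 2 := by gcongr; exact h1.trans h2
    _ = ∫⁻ x, ‖f x‖ₑ ^ 2 ∂ρ := (lintegral_enorm_sq_eq_eLpNorm ρ f).symm
    _ = _ := by
      rw [lintegral_withDensity_eq_lintegral_mul _ hk' (hf.enorm.pow_const 2)]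
      rfl

lemma measurable_torusConv (hk : Continuous k) {f : ℝ × (Fin d → ℝ) → ℝ} (hf : Measurable f) :
    Measurable fun p : ℝ × (Fin d → ℝ) => torusConv k (fun θ => f (p.1, θ)) p.2 := by
  have : StronglyMeasurable fun q : (ℝ × (Fin d → ℝ)) × (Fin d → ℝ) =>
      k (q.1.2 - q.2) * f (q.1.1, q.2) := by
    refine Measurable.stronglyMeasurable ?_
    have h1 : Measurable fun q : (ℝ × (Fin d → ℝ)) × (Fin d → ℝ) => k (q.1.2 - q.2) :=
      (by fun_prop : Continuous fun q : (ℝ × (Fin d → ℝ)) × (Fin d → ℝ) =>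
        k (q.1.2 - q.2)).measurable
    exact h1.mul (hf.comp (by fun_prop))
  exact this.integral_prod_right'.measurable

lemma IsPeriodicMollifier.eLpNorm_torusConv_le (hk : IsPeriodicMollifier k) (ν : Measure ℝ)
    [IsFiniteMeasure ν] {f : ℝ × (Fin d → ℝ) → ℝ} (hf : Measurable f) :
    eLpNorm (fun p : ℝ × (Fin d → ℝ) => torusConv k (fun θ => f (p.1, θ)) p.2) 2
      (ν.prod (volume.restrict (cubeR d))) ≤
    eLpNorm f 2 (ν.prod (volume.restrict (cubeR d))) := by
  set μ : Measure (Fin d → ℝ) := volume.restrict (cubeR d)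
  have hkc : Continuous k := hk.contDiff.continuous
  have hm := measurable_torusConv hkc hf
  have key : ∫⁻ p, ‖torusConv k (fun θ => f (p.1, θ)) p.2‖ₑ ^ 2 ∂(ν.prod μ) ≤
      ∫⁻ p, ‖f p‖ₑ ^ 2 ∂(ν.prod μ) := by
    rw [lintegral_prod _ (hm.enorm.pow_const 2).aemeasurable, lintegral_prod _ (by fun_prop)]
    refine lintegral_mono fun s => ?_
    calc ∫⁻ θ, ‖torusConv k (fun θ => f (s, θ)) θ‖ₑ ^ 2 ∂μ
        ≤ ∫⁻ θ, ∫⁻ θ', ENNReal.ofReal (k (θ - θ')) * ‖f (s, θ')‖ₑ ^ 2 ∂μ ∂μ := by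
          refine lintegral_mono fun θ => enorm_integral_mul_sq_le (by fun_prop)
            (fun x => hk.nonneg _) ?_ (hk.integral_left θ) (by fun_prop)
          exact Continuous.integrable_cubeR (by fun_prop)
      _ = ∫⁻ θ', ∫⁻ θ, ENNReal.ofReal (k (θ - θ')) * ‖f (s, θ')‖ₑ ^ 2 ∂μ ∂μ := by
          refine lintegral_lintegral_swap (Measurable.aemeasurable ?_)
          have h1 : Measurable fun q : (Fin d → ℝ) × (Fin d → ℝ) => k (q.1 - q.2) :=
            (by fun_prop : Continuous fun q : (Fin d → ℝ) × (Fin d → ℝ) =>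
              k (q.1 - q.2)).measurable
          exact h1.ennreal_ofReal.mul (by fun_prop)
      _ = ∫⁻ θ', ‖f (s, θ')‖ₑ ^ 2 ∂μ := by
          refine lintegral_congr fun θ' => ?_
          rw [lintegral_mul_const _ (by fun_prop), ← ofReal_integral_eq_lintegral_ofReal
            (Continuous.integrable_cubeR (by fun_prop)) (.of_forall fun _ => hk.nonneg _),
            hk.integral_right θ', ENNReal.ofReal_one, one_mul]
  rw [lintegral_enorm_sq_eq_eLpNorm, lintegral_enorm_sq_eq_eLpNorm] at key
  exact (ENNReal.pow_le_pow_left_iff two_ne_zero).1 key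

lemma tendsto_eLpNorm_two_of_bounded {α : Type*} [MeasurableSpace α] {μ : Measure α}
    [IsFiniteMeasure μ] {F : ℕ → α → ℝ} (hF : ∀ n, Measurable (F n)) {B : ℝ}
    (hB : ∀ n x, |F n x| ≤ B) (hlim : ∀ᵐ x ∂μ, Tendsto (fun n => F n x) atTop (𝓝 0)) :
    Tendsto (fun n => eLpNorm (F n) 2 μ) atTop (𝓝 0) := by
  have h : Tendsto (fun n => ∫⁻ x, ‖F n x‖ₑ ^ 2 ∂μ) atTop (𝓝 (∫⁻ _, 0 ∂μ)) := by
    refine tendsto_lintegral_of_dominated_convergence (fun _ => ENNReal.ofReal B ^ 2)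
      (fun n => (hF n).enorm.pow_const 2) (fun n => .of_forall fun x => ?_) ?_ ?_
    · dsimp only
      gcongr
      rw [← ofReal_norm, Real.norm_eq_abs]
      exact ENNReal.ofReal_le_ofReal (hB n x)
    · rw [lintegral_const]
      exact ENNReal.mul_ne_top (by simp) (measure_ne_top _ _)
    · filter_upwards [hlim] with x hx
      simpa [Function.comp_def] using (ENNReal.continuous_pow 2).continuousAt.tendsto.comp hx.enorm
  rw [lintegral_zero] at h
  have h2 := (ENNReal.continuous_rpow_const (y := (1 / 2 : ℝ))).continuousAt.tendsto.comp h
  simp only [Function.comp_def, lintegral_enorm_sq_eq_eLpNorm] at h2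
  convert h2 using 2 with n
  · rw [← ENNReal.rpow_natCast, ← ENNReal.rpow_mul]
    norm_num
  · simp

lemma IsPeriodicMollifier.abs_torusConv_le (hk : IsPeriodicMollifier k) {f : (Fin d → ℝ) → ℝ}
    {B : ℝ} (hB : ∀ θ, |f θ| ≤ B) (θ : Fin d → ℝ) : |torusConv k f θ| ≤ B := by
  have hkc := hk.contDiff.continuous
  calc |torusConv k f θ| ≤ ∫ θ' in cubeR d, k (θ - θ') * B := by
        have hi : Continuous fun θ' => k (θ - θ') * B := by fun_prop
        rw [← Real.norm_eq_abs, torusConv]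
        refine norm_integral_le_of_norm_le hi.integrable_cubeR (.of_forall fun θ' => ?_)
        rw [norm_mul, Real.norm_of_nonneg (hk.nonneg _)]
        exact mul_le_mul_of_nonneg_left (hB _) (hk.nonneg _)
    _ = B := by rw [integral_mul_const, hk.integral_left, one_mul]

lemma torusConv_sub (hk : Continuous k) {f h : (Fin d → ℝ) → ℝ}
    (hf : IntegrableOn f (cubeR d)) (hh : IntegrableOn h (cubeR d)) (θ : Fin d → ℝ) :
    torusConv k (fun x => f x - h x) θ = torusConv k f θ - torusConv k h θ := by
  have hint : ∀ g : (Fin d → ℝ) → ℝ, IntegrableOn g (cubeR d) →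
      IntegrableOn (fun θ' => k (θ - θ') * g θ') (cubeR d) := by
    intro g hg
    rw [IntegrableOn, restrict_cubeR_eq_restrict_Icc] at hg ⊢
    exact IntegrableOn.continuousOn_mul (by fun_prop) hg isCompact_Icc
  simp only [torusConv, mul_sub]
  exact integral_sub (hint f hf) (hint h hh)

/-- Mollification by `cosKernel d n` in the space variable converges in `L²`. -/
lemma tendsto_eLpNorm_torusConv_cosKernel (ν : Measure ℝ) [IsFiniteMeasure ν]
    {f : ℝ × (Fin d → ℝ) → ℝ} (hf : Measurable f)
    (hf2 : MemLp f 2 (ν.prod (volume.restrict (cubeR d)))) :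
    Tendsto (fun n => eLpNorm (fun p : ℝ × (Fin d → ℝ) =>
      torusConv (cosKernel d n) (fun θ => f (p.1, θ)) p.2 - f p) 2
      (ν.prod (volume.restrict (cubeR d)))) atTop (𝓝 0) := by
  set μ : Measure (Fin d → ℝ) := volume.restrict (cubeR d)
  have hk := isPeriodicMollifier_cosKernel d
  have hkc : ∀ n, Continuous (cosKernel d n) := fun n => (hk n).contDiff.continuous
  rw [ENNReal.tendsto_atTop_zero]
  intro ε hε
  have hε3 : ε / 3 ≠ 0 := (ENNReal.div_pos hε.ne' (by simp)).ne'
  obtain ⟨h, B, hhc, hhB, hh⟩ : ∃ (h : ℝ × (Fin d → ℝ) → ℝ) (B : ℝ), Continuous h ∧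
      (∀ p, |h p| ≤ B) ∧ eLpNorm (f - h) 2 (ν.prod μ) ≤ ε / 3 := by
    obtain ⟨h, hh, -⟩ := hf2.exists_boundedContinuous_eLpNorm_sub_le (by simp) hε3
    exact ⟨h, ‖h‖, h.continuous, h.norm_coe_le_norm, hh⟩
  have hhm : Measurable h := hhc.measurable
  have hlim : Tendsto (fun n => eLpNorm (fun p : ℝ × (Fin d → ℝ) =>
      torusConv (cosKernel d n) (fun θ => h (p.1, θ)) p.2 - h p) 2 (ν.prod μ)) atTop (𝓝 0) := by
    refine tendsto_eLpNorm_two_of_bounded (B := B + B)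
      (fun n => (measurable_torusConv (hkc n) hhm).sub hhm) (fun n p => ?_) ?_
    · exact (abs_sub _ _).trans (add_le_add ((hk n).abs_torusConv_le (fun _ => hhB _) _) (hhB p))
    · have : ∀ᵐ p ∂(ν.prod μ), p.2 ∈ interior (Icc (0 : Fin d → ℝ) 1) :=
        Measure.quasiMeasurePreserving_snd.ae (ae_mem_interior_cubeR d)
      filter_upwards [this] with p hp
      have := tendsto_torusConv_cosKernel (f := fun θ => h (p.1, θ)) (by fun_prop) hp
      simpa using this.sub_const (h p)
  obtain ⟨N, hN⟩ := ENNReal.tendsto_atTop_zero.1 hlim (ε / 3) (pos_iff_ne_zero.2 hε3)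
  refine ⟨N, fun n hn => ?_⟩
  have hfi : ∀ᵐ p ∂(ν.prod μ), Integrable (fun θ => f (p.1, θ)) μ :=
    Measure.quasiMeasurePreserving_fst.ae (hf2.integrable one_le_two).prod_right_ae
  have hdecomp : (fun p : ℝ × (Fin d → ℝ) =>
        torusConv (cosKernel d n) (fun θ => f (p.1, θ)) p.2 - f p) =ᵐ[ν.prod μ]
      (fun p => torusConv (cosKernel d n) (fun θ => (f - h) (p.1, θ)) p.2) +
        ((fun p => torusConv (cosKernel d n) (fun θ => h (p.1, θ)) p.2 - h p) -
        (f - h)) := by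
    filter_upwards [hfi] with p hp
    have := torusConv_sub (hkc n) hp
      (Continuous.integrable_cubeR (f := fun θ => h (p.1, θ)) (by fun_prop)) p.2
    simp only [Pi.add_apply, Pi.sub_apply] at this ⊢
    rw [this]
    ring
  have hfh : Measurable (f - h) := hf.sub hhm
  rw [eLpNorm_congr_ae hdecomp]
  calc _ ≤ eLpNorm (fun p : ℝ × (Fin d → ℝ) =>
          torusConv (cosKernel d n) (fun θ => (f - h) (p.1, θ)) p.2) 2 (ν.prod μ) +
        (eLpNorm (fun p : ℝ × (Fin d → ℝ) =>
          torusConv (cosKernel d n) (fun θ => h (p.1, θ)) p.2 - h p) 2 (ν.prod μ) +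
        eLpNorm (f - h) 2 (ν.prod μ)) := by
        have m1 := (measurable_torusConv (hkc n) hfh).aestronglyMeasurable (μ := ν.prod μ)
        have m2 := ((measurable_torusConv (hkc n) hhm).sub hhm).aestronglyMeasurable
          (μ := ν.prod μ)
        have m3 := hfh.aestronglyMeasurable (μ := ν.prod μ)
        exact (eLpNorm_add_le m1 (m2.sub m3) one_le_two).trans
          (add_le_add le_rfl (eLpNorm_sub_le m2 m3 one_le_two))
    _ ≤ ε / 3 + (ε / 3 + ε / 3) :=
        add_le_add (((hk n).eLpNorm_torusConv_le ν hfh).trans hh) (add_le_add (hN n hn) hh)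
    _ = ε := by rw [← add_assoc, ENNReal.add_thirds]

lemma fderiv_single_contDiff (hk : ContDiff ℝ ∞ k) (i : Fin d) :
    ContDiff ℝ ∞ fun z => fderiv ℝ k z (Pi.single i 1) :=
  (hk.fderiv_right (m := ∞) (by simp)).clm_apply contDiff_const

lemma hasFDerivAt_torusConv (hk : ContDiff ℝ ∞ k) {f : (Fin d → ℝ) → ℝ}
    (hf : IntegrableOn f (cubeR d)) (θ : Fin d → ℝ) :
    HasFDerivAt (torusConv k f) (∫ θ' in cubeR d, f θ' • fderiv ℝ k (θ - θ')) θ := by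
  have hkc := hk.continuous
  have hk'c : Continuous (fderiv ℝ k) := hk.continuous_fderiv (by simp)
  have hcomp : IsCompact (image (fun q : (Fin d → ℝ) × (Fin d → ℝ) => q.1 - q.2)
      (Metric.closedBall θ 1 ×ˢ Icc 0 1)) :=
    ((isCompact_closedBall θ 1).prod isCompact_Icc).image (by fun_prop)
  obtain ⟨B, hB⟩ := hcomp.exists_bound_of_continuousOn hk'c.continuousOn
  rw [IntegrableOn, restrict_cubeR_eq_restrict_Icc] at hf
  unfold torusConv
  rw [restrict_cubeR_eq_restrict_Icc]
  refine hasFDerivAt_integral_of_dominated_of_fderiv_le (bound := fun θ' => |f θ'| * B)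
    (F' := fun θ θ' => f θ' • fderiv ℝ k (θ - θ'))
    (Metric.closedBall_mem_nhds θ zero_lt_one) (.of_forall fun x => ?_) ?_ ?_ ?_ ?_ ?_
  · exact (by fun_prop : Continuous fun θ' => k (x - θ')).aestronglyMeasurable.mul hf.1
  · exact IntegrableOn.continuousOn_mul (by fun_prop) hf isCompact_Icc
  · exact hf.1.smul (by fun_prop : Continuous fun θ' => fderiv ℝ k (θ - θ')).aestronglyMeasurable
  · filter_upwards [ae_restrict_mem measurableSet_Icc] with θ' hθ' x hx
    rw [norm_smul, Real.norm_eq_abs]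
    exact mul_le_mul_of_nonneg_left (hB _ ⟨(x, θ'), ⟨hx, hθ'⟩, rfl⟩) (abs_nonneg _)
  · exact hf.abs.mul_const B
  · refine .of_forall fun θ' x _ => ?_
    have h1 : HasFDerivAt k (fderiv ℝ k (x - θ')) (x - θ') :=
      (hk.differentiable (by simp)).differentiableAt.hasFDerivAt
    have h2 := (h1.comp x ((hasFDerivAt_id x).sub_const θ')).mul_const (f θ')
    simpa [Function.comp_def] using h2

lemma continuous_torusConv (hk : ContDiff ℝ ∞ k) {f : (Fin d → ℝ) → ℝ}
    (hf : IntegrableOn f (cubeR d)) : Continuous (torusConv k f) :=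
  continuous_iff_continuousAt.2 fun θ => (hasFDerivAt_torusConv hk hf θ).continuousAt

lemma integral_smul_fderiv_apply (hk : ContDiff ℝ ∞ k) {f : (Fin d → ℝ) → ℝ}
    (hf : IntegrableOn f (cubeR d)) (θ v : Fin d → ℝ) :
    (∫ θ' in cubeR d, f θ' • fderiv ℝ k (θ - θ')) v =
      torusConv (fun z => fderiv ℝ k z v) f θ := by
  have hk'c : Continuous (fderiv ℝ k) := hk.continuous_fderiv (by simp)
  rw [ContinuousLinearMap.integral_apply]
  · simp only [torusConv, _root_.smul_apply, smul_eq_mul, mul_comm]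
  · rw [IntegrableOn, restrict_cubeR_eq_restrict_Icc] at hf
    rw [restrict_cubeR_eq_restrict_Icc]
    exact IntegrableOn.smul_continuousOn hf (by fun_prop) isCompact_Icc

lemma SpacePeriodic.sub_right (hk : SpacePeriodic k) (a : Fin d → ℝ) :
    SpacePeriodic fun θ => k (θ - a) := by
  intro θ i
  dsimp only
  rw [← hk (θ - a) i]
  congr 1
  ext j
  by_cases h : j = i
  · subst h; simp; ring
  · simp [h]

lemma SpacePeriodic.sub_left (hk : SpacePeriodic k) (a : Fin d → ℝ) :
    SpacePeriodic fun θ => k (a - θ) := by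
  intro θ i
  dsimp only
  rw [← hk (a - Function.update θ i (θ i + 1)) i]
  congr 1
  ext j
  by_cases h : j = i
  · subst h; simp; ring
  · simp [h]

lemma SpacePeriodic.torusConv (hk : SpacePeriodic k) (f : (Fin d → ℝ) → ℝ) :
    SpacePeriodic (torusConv k f) := fun θ i =>
  integral_congr_ae (.of_forall fun θ' => by
    have := hk.sub_right θ' θ i
    dsimp only at this ⊢
    rw [this])

end Convolution

section IntegrationByParts

/-- The integral of a partial derivative of a periodic `C¹` function vanishes. -/
lemma SpacePeriodic.integral_fderiv_eq_zero {d : ℕ} {V : (Fin d → ℝ) → ℝ}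
    {V' : (Fin d → ℝ) → (Fin d → ℝ) →L[ℝ] ℝ} (hp : SpacePeriodic V)
    (hV : ∀ θ, HasFDerivAt V (V' θ) θ) (i : Fin d)
    (hV' : Continuous fun θ => V' θ (Pi.single i 1)) :
    ∫ θ in cubeR d, V' θ (Pi.single i 1) = 0 := by
  obtain _ | n := d
  · exact i.elim0
  have hVc : Continuous V := continuous_iff_continuousAt.2 fun θ => (hV θ).continuousAt
  have hint : IntegrableOn (fun θ => V' θ (Pi.single i 1)) (Icc 0 1) :=
    hV'.continuousOn.integrableOn_compact isCompact_Icc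
  have hsum : ∀ θ, ∑ j, (if j = i then V' else 0) θ (Pi.single j 1) = V' θ (Pi.single i 1) := by
    intro θ
    rw [Finset.sum_eq_single i]
    · simp
    · intro j _ hj
      simp [hj]
    · simp
  have h := integral_divergence_of_hasFDerivAt_off_countable' (0 : Fin (n + 1) → ℝ) 1
    zero_le_one (fun j => if j = i then V else 0) (fun j => if j = i then V' else 0) ∅
    countable_empty
    (fun j => by
      by_cases hj : j = i
      · simpa [hj] using hVc.continuousOn
      · simpa [hj] using! continuousOn_const)
    (fun x _ j => by
      by_cases hj : j = i
      · simpa [hj] using hV x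
      · simpa [hj] using! hasFDerivAt_const (0 : ℝ) x)
    (by simpa only [hsum] using hint)
  simp only [hsum] at h
  rw [restrict_cubeR_eq_restrict_Icc, h]
  refine Finset.sum_eq_zero fun j _ => ?_
  by_cases hj : j = i
  · subst hj
    rw [sub_eq_zero]
    refine integral_congr_ae (.of_forall fun x => ?_)
    have := hp (j.insertNth (0 : ℝ) x) j
    simpa using this
  · simp [hj]

lemma LipschitzWith.comp_absolutelyContinuousOnInterval {X Y : Type*} [PseudoMetricSpace X]
    [PseudoMetricSpace Y] {K : NNReal} {Ψ : X → Y} (hΨ : LipschitzWith K Ψ) {f : ℝ → X} {a b : ℝ}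
    (hf : AbsolutelyContinuousOnInterval f a b) :
    AbsolutelyContinuousOnInterval (fun t => Ψ (f t)) a b := by
  unfold AbsolutelyContinuousOnInterval at hf ⊢
  refine squeeze_zero (fun t => Finset.sum_nonneg fun i _ => dist_nonneg) (fun t => ?_)
    (by simpa using hf.const_mul (K : ℝ))
  rw [Finset.mul_sum]
  exact Finset.sum_le_sum fun i _ => hΨ.dist_le_mul _ _

/-- The chain rule for the primitive of an integrable function. -/
lemma comp_integral_sub_eq_integral {T : ℝ} {f : ℝ → ℝ}
    (hf : IntervalIntegrable f volume 0 T) {Ψ Ψ' : ℝ → ℝ} {K : NNReal}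
    (hΨ : ∀ x, HasDerivAt Ψ (Ψ' x) x) (hK : ∀ x, |Ψ' x| ≤ K) :
    Ψ (∫ s in (0 : ℝ)..T, f s) - Ψ 0 =
      ∫ t in (0 : ℝ)..T, Ψ' (∫ s in (0 : ℝ)..t, f s) * f t := by
  have hlip : LipschitzWith K Ψ := lipschitzWith_of_nnnorm_deriv_le
    (fun x => (hΨ x).differentiableAt) fun x => by
      rw [(hΨ x).deriv]
      exact_mod_cast hK x
  have hac := hf.absolutelyContinuousOnInterval_intervalIntegral (c := 0) (by simp)
  have h := (hlip.comp_absolutelyContinuousOnInterval hac).integral_deriv_eq_sub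
  simp only [intervalIntegral.integral_same] at h
  rw [← h]
  refine intervalIntegral.integral_congr_ae ?_
  filter_upwards [hf.ae_hasDerivAt_integral] with t ht ht'
  exact ((hΨ _).comp t (ht (uIoc_subset_uIcc ht') 0 (by simp))).deriv

lemma ae_eq_zero_of_integral_smooth_mul_eq_zero {T : ℝ} (hT : 0 < T) {c : ℝ → ℝ}
    (hc : IntervalIntegrable c volume 0 T)
    (h : ∀ η : ℝ → ℝ, ContDiff ℝ ∞ η → ∫ t in (0 : ℝ)..T, η t * c t = 0) :
    ∀ᵐ t ∂volume.restrict (Ioc 0 T), c t = 0 := by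
  rw [intervalIntegrable_iff_integrableOn_Ioc_of_le hT.le] at hc
  have := isOpen_Ioo.ae_eq_zero_of_integral_contDiff_smul_eq_zero (μ := volume) (U := Ioo 0 T)
    (f := c) (hc.mono_set Ioo_subset_Ioc_self).locallyIntegrableOn (fun η hη _ hsupp => by
      rw [← h η hη, intervalIntegral.integral_of_le hT.le]
      refine (setIntegral_eq_integral_of_forall_compl_eq_zero fun t ht => ?_).symm
      have : η t = 0 := by
        by_contra hne
        exact ht (Ioo_subset_Ioc_self (hsupp (subset_tsupport η hne)))
      simp [this])
  rw [Measure.restrict_congr_set (Ioo_ae_eq_Ioc (μ := (volume : Measure ℝ))).symm]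
  rwa [ae_restrict_iff' measurableSet_Ioo]

lemma exists_contDiff_deriv_eq {ζ : ℝ → ℝ} (hζ : ContDiff ℝ ∞ ζ) :
    ∃ η : ℝ → ℝ, ContDiff ℝ ∞ η ∧ deriv η = ζ := by
  have hd : ∀ t, HasDerivAt (fun t => ∫ s in (0 : ℝ)..t, ζ s) (ζ t) t := fun t =>
    hζ.continuous.integral_hasStrictDerivAt 0 t |>.hasDerivAt
  have hd' : deriv (fun t => ∫ s in (0 : ℝ)..t, ζ s) = ζ := funext fun t => (hd t).deriv
  refine ⟨_, ?_, hd'⟩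
  rw [contDiff_infty_iff_deriv, hd']
  exact ⟨fun t => (hd t).differentiableAt, hζ⟩

/-- A continuous function with weak derivative `-b` is a primitive of `-b`. -/
lemma eq_neg_integral_of_weak_deriv {T : ℝ} (hT : 0 < T) {a b : ℝ → ℝ} (ha : Continuous a)
    (hb : IntervalIntegrable b volume 0 T)
    (h : ∀ η : ℝ → ℝ, ContDiff ℝ ∞ η → η T * a T =
      (∫ t in (0 : ℝ)..T, deriv η t * a t) - ∫ t in (0 : ℝ)..T, η t * b t) :
    ∀ t ∈ Icc 0 T, a t = -∫ s in (0 : ℝ)..t, b s := by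
  set B : ℝ → ℝ := fun t => ∫ s in (0 : ℝ)..t, b s with hB
  have hBac : AbsolutelyContinuousOnInterval B 0 T :=
    hb.absolutelyContinuousOnInterval_intervalIntegral (c := 0) (by simp)
  have hBc : ContinuousOn B (uIcc 0 T) := hBac.continuousOn
  have hparts : ∀ η : ℝ → ℝ, ContDiff ℝ ∞ η →
      ∫ t in (0 : ℝ)..T, deriv η t * (a t + B t) = η T * (a T + B T) := by
    intro η hη
    have hη' : Continuous (deriv η) := hη.continuous_deriv (by simp)
    have hηac : AbsolutelyContinuousOnInterval η 0 T :=
      (hη.of_le (by simp)).contDiffOn.absolutelyContinuousOnInterval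
    have h1 := hηac.integral_mul_deriv_eq_deriv_mul hBac
    have h2 : ∫ t in (0 : ℝ)..T, η t * deriv B t = ∫ t in (0 : ℝ)..T, η t * b t := by
      refine intervalIntegral.integral_congr_ae ?_
      filter_upwards [hb.ae_hasDerivAt_integral] with t ht ht'
      rw [(ht (uIoc_subset_uIcc ht') 0 (by simp)).deriv]
    have hB0 : B 0 = 0 := by simp [hB]
    rw [h2, hB0, mul_zero, sub_zero] at h1
    simp only [mul_add]
    have i1 : IntervalIntegrable (fun t => deriv η t * a t) volume 0 T :=
      (hη'.mul ha).intervalIntegrable _ _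
    have i2 : IntervalIntegrable (fun t => deriv η t * B t) volume 0 T :=
      (hη'.continuousOn.mul hBc).intervalIntegrable
    rw [intervalIntegral.integral_add i1 i2]
    linarith [h η hη]
  have hend : a T + B T = 0 := by
    simpa using (hparts (fun _ => 1) contDiff_const).symm
  have hzero : ∀ᵐ t ∂volume.restrict (Ioc 0 T), a t + B t = 0 := by
    refine ae_eq_zero_of_integral_smooth_mul_eq_zero hT
      (ha.continuousOn.add hBc).intervalIntegrable fun ζ hζ => ?_
    obtain ⟨η, hη, rfl⟩ := exists_contDiff_deriv_eq hζ
    rw [hparts η hη, hend, mul_zero]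
  rw [Measure.restrict_congr_set (Ioc_ae_eq_Icc (μ := (volume : Measure ℝ)))] at hzero
  rw [uIcc_of_le hT.le] at hBc
  have := Measure.eqOn_Icc_of_ae_eq volume hT.ne hzero (ha.continuousOn.add hBc)
    continuousOn_const
  intro t ht
  linarith [this ht]

end IntegrationByParts

section ProductLimits

variable {α : Type*} [MeasurableSpace α] {m : Measure α}

lemma eLpNorm_mul_one_le {f h : α → ℝ} (hf : AEStronglyMeasurable f m)
    (hh : AEStronglyMeasurable h m) :
    eLpNorm (fun x => f x * h x) 1 m ≤ eLpNorm f 2 m * eLpNorm h 2 m := by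
  have h := eLpNorm_smul_le_mul_eLpNorm (p := 2) (q := 2) (r := 1) hh hf
  simpa only [Pi.smul_def', smul_eq_mul] using! h

/-- The product of two `L²`-convergent sequences converges in `L¹`. -/
lemma tendsto_eLpNorm_mul_sub {b c : α → ℝ} {bn cn : ℕ → α → ℝ} (hb : MemLp b 2 m)
    (hc : MemLp c 2 m) (hbn : ∀ n, MemLp (bn n) 2 m) (hcn : ∀ n, MemLp (cn n) 2 m)
    (hbt : Tendsto (fun n => eLpNorm (fun x => bn n x - b x) 2 m) atTop (𝓝 0))
    (hct : Tendsto (fun n => eLpNorm (fun x => cn n x - c x) 2 m) atTop (𝓝 0)) :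
    Tendsto (fun n => eLpNorm (fun x => bn n x * cn n x - b x * c x) 1 m) atTop (𝓝 0) := by
  have hlim : Tendsto (fun n =>
      eLpNorm (fun x => bn n x - b x) 2 m * eLpNorm (fun x => cn n x - c x) 2 m
        + eLpNorm (fun x => bn n x - b x) 2 m * eLpNorm c 2 m
        + eLpNorm b 2 m * eLpNorm (fun x => cn n x - c x) 2 m) atTop (𝓝 0) := by
    have h1 := ENNReal.Tendsto.mul hbt (.inr (by simp)) hct (.inr (by simp))
    have h2 := ENNReal.Tendsto.mul_const (b := eLpNorm c 2 m) hbt (.inr hc.2.ne)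
    have h3 := ENNReal.Tendsto.const_mul (a := eLpNorm b 2 m) hct (.inr hb.2.ne)
    simpa using (h1.add h2).add h3
  refine tendsto_of_tendsto_of_tendsto_of_le_of_le tendsto_const_nhds hlim (fun _ => zero_le)
    fun n => ?_
  have hb' := (hbn n).1.sub hb.1
  have hc' := (hcn n).1.sub hc.1
  have heq : (fun x => bn n x * cn n x - b x * c x) =
      ((fun x => (bn n x - b x) * (cn n x - c x)) + fun x => (bn n x - b x) * c x)
        + fun x => b x * (cn n x - c x) := by
    ext x
    simp only [Pi.add_apply]
    ring
  rw [heq]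
  refine (eLpNorm_add_le ((hb'.mul hc').add (hb'.mul hc.1)) (hb.1.mul hc') le_rfl).trans ?_
  gcongr
  · refine (eLpNorm_add_le (hb'.mul hc') (hb'.mul hc.1) le_rfl).trans ?_
    gcongr
    · exact eLpNorm_mul_one_le hb' hc'
    · exact eLpNorm_mul_one_le hb' hc.1
  · exact eLpNorm_mul_one_le hb.1 hc'

lemma tendsto_integral_mul_of_ae_of_L1 {a f : α → ℝ} {an fn : ℕ → α → ℝ} {M : ℝ}
    (han : ∀ n, AEStronglyMeasurable (an n) m) (hM : ∀ n x, |an n x| ≤ M)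
    (hat : ∀ᵐ x ∂m, Tendsto (fun n => an n x) atTop (𝓝 (a x)))
    (hf : Integrable f m) (hfn : ∀ n, Integrable (fn n) m)
    (hft : Tendsto (fun n => eLpNorm (fun x => fn n x - f x) 1 m) atTop (𝓝 0)) :
    Tendsto (fun n => ∫ x, an n x * fn n x ∂m) atTop (𝓝 (∫ x, a x * f x ∂m)) := by
  have h1 : Tendsto (fun n => ∫ x, an n x * f x ∂m) atTop (𝓝 (∫ x, a x * f x ∂m)) := by
    refine tendsto_integral_of_dominated_convergence (fun x => M * |f x|)
      (fun n => (han n).mul hf.1) (hf.abs.const_mul M) (fun n => .of_forall fun x => ?_) ?_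
    · rw [norm_mul, Real.norm_eq_abs, Real.norm_eq_abs]
      exact mul_le_mul_of_nonneg_right (hM n x) (abs_nonneg _)
    · filter_upwards [hat] with x hx
      exact hx.mul_const _
  have hd : ∀ n, Integrable (fun x => an n x * (fn n x - f x)) m := fun n =>
    ((hfn n).sub hf).bdd_mul (han n) (.of_forall (hM n))
  have h2 : Tendsto (fun n => ∫ x, an n x * (fn n x - f x) ∂m) atTop (𝓝 0) := by
    have hz : Tendsto (fun n => M * (eLpNorm (fun x => fn n x - f x) 1 m).toReal) atTop (𝓝 0) := by
      simpa using ((ENNReal.tendsto_toReal ENNReal.zero_ne_top).comp hft).const_mul M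
    refine squeeze_zero_norm (fun n => ?_) hz
    have hm : AEStronglyMeasurable (fun x => fn n x - f x) m := ((hfn n).sub hf).1
    rw [eLpNorm_one_eq_lintegral_enorm, ← integral_norm_eq_lintegral_enorm hm, ← integral_const_mul]
    refine norm_integral_le_of_norm_le (((hfn n).sub hf).norm.const_mul M)
      (.of_forall fun x => ?_)
    rw [norm_mul]
    exact mul_le_mul_of_nonneg_right (hM n x) (norm_nonneg _)
  have h3 := h2.add h1
  rw [zero_add] at h3
  refine h3.congr fun n => ?_
  rw [← integral_add (hd n) (hf.bdd_mul (han n) (.of_forall (hM n)))]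
  congr 1
  ext x
  ring

end ProductLimits

/-- `g` is the weak spatial gradient of the bounded function `w`, and `w` solves
`∂_t w = ∇·F` weakly on `(0,T] × 𝕋^d` with zero initial data. -/
structure IsWeakFluxSolution {d : ℕ} (T : ℝ) (w : ℝ × (Fin d → ℝ) → ℝ)
    (g F : Fin d → ℝ × (Fin d → ℝ) → ℝ) : Prop where
  measurable : Measurable w
  abs_le_one : ∀ p, |w p| ≤ 1
  measurable_grad : ∀ i, Measurable (g i)
  measurable_flux : ∀ i, Measurable (F i)
  memLp_grad : ∀ i, MemLp (g i) 2 ((volume.restrict (Ioc 0 T)).prod (volume.restrict (cubeR d)))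
  memLp_flux : ∀ i, MemLp (F i) 2 ((volume.restrict (Ioc 0 T)).prod (volume.restrict (cubeR d)))
  weak_grad : ∀ φ : (Fin d → ℝ) → ℝ, ContDiff ℝ ∞ φ → SpacePeriodic φ → ∀ i,
    ∀ᵐ t ∂volume.restrict (Ioc 0 T),
      ∫ θ in cubeR d, w (t, θ) * fderiv ℝ φ θ (Pi.single i 1) =
        -∫ θ in cubeR d, g i (t, θ) * φ θ
  weak_eq : ∀ φ : (Fin d → ℝ) → ℝ, ContDiff ℝ ∞ φ → SpacePeriodic φ → ∀ t ∈ Icc 0 T,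
    ∫ θ in cubeR d, φ θ * w (t, θ) =
      -∫ s in (0 : ℝ)..t, ∫ θ in cubeR d, ∑ i, fderiv ℝ φ θ (Pi.single i 1) * F i (s, θ)

namespace IsWeakFluxSolution

variable {d : ℕ} {T : ℝ} {w : ℝ × (Fin d → ℝ) → ℝ} {g F : Fin d → ℝ × (Fin d → ℝ) → ℝ}

lemma mono (h : IsWeakFluxSolution T w g F) {T' : ℝ} (hT : T' ≤ T) :
    IsWeakFluxSolution T' w g F where
  measurable := h.measurable
  abs_le_one := h.abs_le_one
  measurable_grad := h.measurable_grad
  measurable_flux := h.measurable_flux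
  memLp_grad i := (h.memLp_grad i).mono_measure
    (Measure.prod_mono (Measure.restrict_mono (Ioc_subset_Ioc_right hT) le_rfl) le_rfl)
  memLp_flux i := (h.memLp_flux i).mono_measure
    (Measure.prod_mono (Measure.restrict_mono (Ioc_subset_Ioc_right hT) le_rfl) le_rfl)
  weak_grad φ hφ hp i := ae_restrict_of_ae_restrict_of_subset (Ioc_subset_Ioc_right hT)
    (h.weak_grad φ hφ hp i)
  weak_eq φ hφ hp t ht := h.weak_eq φ hφ hp t ⟨ht.1, ht.2.trans hT⟩

end IsWeakFluxSolution

section Regularized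

variable {d : ℕ} {k : (Fin d → ℝ) → ℝ}

lemma exists_abs_sub_le_of_continuous (hk : Continuous k) :
    ∃ B, 0 ≤ B ∧ ∀ θ ∈ cubeR d, ∀ θ' ∈ cubeR d, |k (θ - θ')| ≤ B := by
  have hcomp : IsCompact (image (fun q : (Fin d → ℝ) × (Fin d → ℝ) => q.1 - q.2)
      (Icc 0 1 ×ˢ Icc 0 1)) := (isCompact_Icc.prod isCompact_Icc).image (by fun_prop)
  obtain ⟨B, hB⟩ := hcomp.exists_bound_of_continuousOn hk.continuousOn
  have hsub : ∀ θ ∈ cubeR d, θ ∈ Icc (0 : Fin d → ℝ) 1 := fun θ hθ =>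
    ⟨fun i => (hθ i trivial).1, fun i => (hθ i trivial).2.le⟩
  refine ⟨max B 0, le_max_right _ _, fun θ hθ θ' hθ' => (hB _ ?_).trans (le_max_left _ _)⟩
  exact ⟨(θ, θ'), ⟨hsub θ hθ, hsub θ' hθ'⟩, rfl⟩

lemma abs_torusConv_le_integral {B : ℝ} {f : (Fin d → ℝ) → ℝ} {θ : Fin d → ℝ}
    (hB : ∀ θ' ∈ cubeR d, |k (θ - θ')| ≤ B) (hf : IntegrableOn f (cubeR d)) :
    |torusConv k f θ| ≤ B * ∫ θ' in cubeR d, |f θ'| := by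
  rw [← Real.norm_eq_abs, torusConv, ← integral_const_mul]
  refine norm_integral_le_of_norm_le (hf.abs.const_mul B) ?_
  filter_upwards [ae_restrict_mem (measurableSet_cubeR d)] with θ' hθ'
  rw [norm_mul, Real.norm_eq_abs, Real.norm_eq_abs]
  exact mul_le_mul_of_nonneg_right (hB θ' hθ') (abs_nonneg _)

/-- Space convolutions with a continuous kernel preserve integrability in space-time. -/
lemma integrable_torusConv (hk : Continuous k) {ν : Measure ℝ} [SFinite ν]
    {f : ℝ × (Fin d → ℝ) → ℝ} (hfm : Measurable f)
    (hf : Integrable f (ν.prod (volume.restrict (cubeR d)))) :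
    Integrable (fun p : ℝ × (Fin d → ℝ) => torusConv k (fun θ => f (p.1, θ)) p.2)
      (ν.prod (volume.restrict (cubeR d))) := by
  obtain ⟨B, -, hB⟩ := exists_abs_sub_le_of_continuous hk
  refine Integrable.mono' (hf.abs.integral_prod_left.const_mul B |>.comp_fst _)
    (measurable_torusConv hk hfm).aestronglyMeasurable ?_
  filter_upwards [Measure.quasiMeasurePreserving_fst.ae hf.prod_right_ae,
    Measure.quasiMeasurePreserving_snd.ae (ae_restrict_mem (measurableSet_cubeR d))] with p hp hp'
  exact abs_torusConv_le_integral (hB _ hp') hp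

/-- Space convolutions with a continuous kernel preserve integrability in time. -/
lemma integrable_torusConv_left (hk : Continuous k) {ν : Measure ℝ} [SFinite ν]
    {f : ℝ × (Fin d → ℝ) → ℝ} (hfm : Measurable f)
    (hf : Integrable f (ν.prod (volume.restrict (cubeR d)))) {θ : Fin d → ℝ} (hθ : θ ∈ cubeR d) :
    Integrable (fun t => torusConv k (fun θ' => f (t, θ')) θ) ν := by
  obtain ⟨B, -, hB⟩ := exists_abs_sub_le_of_continuous hk
  refine Integrable.mono' (hf.abs.integral_prod_left.const_mul B)
    ((measurable_torusConv hk hfm).comp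
      (by fun_prop : Measurable fun t : ℝ => (t, θ))).aestronglyMeasurable ?_
  filter_upwards [hf.prod_right_ae] with t ht
  exact abs_torusConv_le_integral (hB θ hθ) ht

end Regularized

lemma fderiv_comp_const_sub {d : ℕ} {k : (Fin d → ℝ) → ℝ} (hk : ContDiff ℝ ∞ k)
    (a x : Fin d → ℝ) : fderiv ℝ (fun y => k (a - y)) x = -fderiv ℝ k (a - x) := by
  have h := ((hk.differentiable (by simp)) (a - x)).hasFDerivAt.comp x
    ((hasFDerivAt_id x).const_sub a)
  refine (h.congr_fderiv ?_).fderiv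
  ext v
  simp

namespace IsWeakFluxSolution

variable {d : ℕ} {T : ℝ} {w : ℝ × (Fin d → ℝ) → ℝ} {g F : Fin d → ℝ × (Fin d → ℝ) → ℝ}
  {k : (Fin d → ℝ) → ℝ}

lemma integrable_flux (h : IsWeakFluxSolution T w g F) (i : Fin d) :
    Integrable (F i) ((volume.restrict (Ioc 0 T)).prod (volume.restrict (cubeR d))) :=
  (h.memLp_flux i).integrable (by norm_num)

lemma integrableOn_slice (h : IsWeakFluxSolution T w g F) (t : ℝ) :
    IntegrableOn (fun θ => w (t, θ)) (cubeR d) :=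
  Integrable.of_bound (h.measurable.comp measurable_prodMk_left).aestronglyMeasurable 1
    (.of_forall fun θ => h.abs_le_one (t, θ))

lemma torusConv_eq_integral (h : IsWeakFluxSolution T w g F) (hk : ContDiff ℝ ∞ k)
    (hp : SpacePeriodic k) (θ : Fin d → ℝ) {t : ℝ} (ht : t ∈ Icc 0 T) :
    torusConv k (fun θ' => w (t, θ')) θ = ∫ s in (0 : ℝ)..t,
      ∑ i, torusConv (fun z => fderiv ℝ k z (Pi.single i 1)) (fun θ' => F i (s, θ')) θ := by
  have hint : ∀ᵐ s ∂volume.restrict (Ioc 0 T), ∀ i,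
      IntegrableOn (fun θ' => F i (s, θ')) (cubeR d) :=
    ae_all_iff.2 fun i => (h.integrable_flux i).prod_right_ae
  rw [torusConv, h.weak_eq (fun θ' => k (θ - θ')) (hk.comp (by fun_prop)) (hp.sub_left θ) t ht,
    ← intervalIntegral.integral_neg, intervalIntegral.integral_of_le ht.1,
    intervalIntegral.integral_of_le ht.1]
  refine integral_congr_ae ?_
  filter_upwards [ae_restrict_of_ae_restrict_of_subset (Ioc_subset_Ioc_right ht.2) hint] with s hs
  have hi : ∀ i, IntegrableOn (fun θ' => fderiv ℝ k (θ - θ') (Pi.single i 1) * F i (s, θ'))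
      (cubeR d) := by
    intro i
    have hc := (fderiv_single_contDiff hk i).continuous
    have := hs i
    rw [IntegrableOn, restrict_cubeR_eq_restrict_Icc] at this ⊢
    exact IntegrableOn.continuousOn_mul (by fun_prop) this isCompact_Icc
  simp only [torusConv]
  rw [← integral_finsetSum _ fun i _ => hi i, ← integral_neg]
  congr 1
  ext θ'
  rw [← Finset.sum_neg_distrib]
  refine Finset.sum_congr rfl fun i _ => ?_
  rw [fderiv_comp_const_sub hk]
  simp

lemma torusConv_fderiv_eq (h : IsWeakFluxSolution T w g F) (hk : ContDiff ℝ ∞ k)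
    (hp : SpacePeriodic k) (i : Fin d) :
    ∀ᵐ t ∂volume.restrict (Ioc 0 T), ∀ᵐ θ ∂volume.restrict (cubeR d),
      torusConv (fun z => fderiv ℝ k z (Pi.single i 1)) (fun θ' => w (t, θ')) θ =
        torusConv k (fun θ' => g i (t, θ')) θ := by
  have hm : MeasurableSet {p : ℝ × (Fin d → ℝ) |
      torusConv (fun z => fderiv ℝ k z (Pi.single i 1)) (fun θ' => w (p.1, θ')) p.2 =
        torusConv k (fun θ' => g i (p.1, θ')) p.2} :=
    measurableSet_eq_fun
      (measurable_torusConv (fderiv_single_contDiff hk i).continuous h.measurable)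
      (measurable_torusConv hk.continuous (h.measurable_grad i))
  rw [Measure.ae_ae_comm hm]
  refine .of_forall fun θ => ?_
  filter_upwards [h.weak_grad (fun θ' => k (θ - θ')) (hk.comp (by fun_prop)) (hp.sub_left θ) i]
    with t ht
  simp only [fderiv_comp_const_sub hk, _root_.neg_apply, mul_neg, integral_neg, neg_inj] at ht
  simpa only [torusConv, mul_comm] using ht

/-- The integration by parts in space behind the regularized entropy identity. -/
lemma integral_comp_torusConv_mul (h : IsWeakFluxSolution T w g F) (hk : ContDiff ℝ ∞ k)
    (hp : SpacePeriodic k) {ψ ψ' : ℝ → ℝ} (hψ : ∀ x, HasDerivAt ψ (ψ' x) x)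
    (hψ' : Continuous ψ') (i : Fin d) :
    ∀ᵐ t ∂volume.restrict (Ioc 0 T),
      ∫ θ in cubeR d, ψ (torusConv k (fun θ' => w (t, θ')) θ) *
          torusConv (fun z => fderiv ℝ k z (Pi.single i 1)) (fun θ' => F i (t, θ')) θ =
        -∫ θ in cubeR d, ψ' (torusConv k (fun θ' => w (t, θ')) θ) *
          (torusConv k (fun θ' => g i (t, θ')) θ * torusConv k (fun θ' => F i (t, θ')) θ) := by
  filter_upwards [h.torusConv_fderiv_eq hk hp i, (h.integrable_flux i).prod_right_ae] with t ht hF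
  have hw := h.integrableOn_slice t
  have hki := fderiv_single_contDiff hk i
  have hψc : Continuous ψ := continuous_iff_continuousAt.2 fun x => (hψ x).continuousAt
  set W := torusConv k (fun θ' => w (t, θ')) with hW
  set A := torusConv k (fun θ' => F i (t, θ')) with hA
  set Wi := torusConv (fun z => fderiv ℝ k z (Pi.single i 1)) (fun θ' => w (t, θ')) with hWi
  set Ai := torusConv (fun z => fderiv ℝ k z (Pi.single i 1)) (fun θ' => F i (t, θ')) with hAi
  have cW : Continuous W := continuous_torusConv hk hw
  have cA : Continuous A := continuous_torusConv hk hF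
  have cWi : Continuous Wi := continuous_torusConv hki hw
  have cAi : Continuous Ai := continuous_torusConv hki hF
  have hV := fun θ => ((hψ (W θ)).comp_hasFDerivAt θ (hasFDerivAt_torusConv hk hw θ)).mul
    (hasFDerivAt_torusConv hk hF θ)
  have hper : SpacePeriodic fun θ => ψ (W θ) * A θ := by
    intro θ j
    simp only [hW, hA, hp.torusConv _ θ j]
  have key := SpacePeriodic.integral_fderiv_eq_zero hper hV i
  simp only [_root_.add_apply, _root_.smul_apply, integral_smul_fderiv_apply hk hw,
    integral_smul_fderiv_apply hk hF, smul_eq_mul, Function.comp_apply] at key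
  rw [← hWi, ← hAi, ← hA] at key
  have key' := key (by fun_prop)
  have i1 : Continuous fun θ => ψ (W θ) * Ai θ := by fun_prop
  have i2 : Continuous fun θ => A θ * (ψ' (W θ) * Wi θ) := by fun_prop
  rw [integral_add i1.integrable_cubeR i2.integrable_cubeR] at key'
  rw [eq_neg_of_add_eq_zero_left key', neg_inj]
  refine integral_congr_ae ?_
  filter_upwards [ht] with θ hθ
  rw [hθ]
  ring

lemma measurable_torusConv_slice (h : IsWeakFluxSolution T w g F) (hk : Continuous k) :
    Measurable fun p : ℝ × (Fin d → ℝ) => torusConv k (fun θ' => w (p.1, θ')) p.2 :=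
  measurable_torusConv hk h.measurable

lemma memLp_torusConv_grad (h : IsWeakFluxSolution T w g F) (hk : IsPeriodicMollifier k)
    (i : Fin d) : MemLp (fun p : ℝ × (Fin d → ℝ) => torusConv k (fun θ' => g i (p.1, θ')) p.2) 2
      ((volume.restrict (Ioc 0 T)).prod (volume.restrict (cubeR d))) :=
  ⟨(measurable_torusConv hk.contDiff.continuous (h.measurable_grad i)).aestronglyMeasurable,
    (hk.eLpNorm_torusConv_le _ (h.measurable_grad i)).trans_lt (h.memLp_grad i).2⟩

lemma memLp_torusConv_flux (h : IsWeakFluxSolution T w g F) (hk : IsPeriodicMollifier k)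
    (i : Fin d) : MemLp (fun p : ℝ × (Fin d → ℝ) => torusConv k (fun θ' => F i (p.1, θ')) p.2) 2
      ((volume.restrict (Ioc 0 T)).prod (volume.restrict (cubeR d))) :=
  ⟨(measurable_torusConv hk.contDiff.continuous (h.measurable_flux i)).aestronglyMeasurable,
    (hk.eLpNorm_torusConv_le _ (h.measurable_flux i)).trans_lt (h.memLp_flux i).2⟩

/-- The entropy identity for the mollified solution. -/
lemma integral_comp_torusConv (h : IsWeakFluxSolution T w g F) (hT : 0 < T)
    (hk : IsPeriodicMollifier k) {Ψ ψ ψ' : ℝ → ℝ} {K : NNReal} {M : ℝ}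
    (hΨ : ∀ x, HasDerivAt Ψ (ψ x) x) (hψ : ∀ x, HasDerivAt ψ (ψ' x) x) (hψ' : Continuous ψ')
    (hK : ∀ x, |ψ x| ≤ K) (hM : ∀ x, |ψ' x| ≤ M) :
    (∫ θ in cubeR d, Ψ (torusConv k (fun θ' => w (T, θ')) θ)) - Ψ 0 =
      -∑ i, ∫ p, ψ' (torusConv k (fun θ' => w (p.1, θ')) p.2) *
          (torusConv k (fun θ' => g i (p.1, θ')) p.2 * torusConv k (fun θ' => F i (p.1, θ')) p.2)
        ∂((volume.restrict (Ioc 0 T)).prod (volume.restrict (cubeR d))) := by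
  have hkc := hk.contDiff
  have hki := fderiv_single_contDiff hkc
  have hψc : Continuous ψ := continuous_iff_continuousAt.2 fun x => (hψ x).continuousAt
  have hΨc : Continuous Ψ := continuous_iff_continuousAt.2 fun x => (hΨ x).continuousAt
  have hWm := h.measurable_torusConv_slice hkc.continuous
  set f : Fin d → ℝ × (Fin d → ℝ) → ℝ := fun i p =>
    torusConv (fun z => fderiv ℝ k z (Pi.single i 1)) (fun θ' => F i (p.1, θ')) p.2 with hf
  have hf1 : ∀ i, Integrable (fun p : ℝ × (Fin d → ℝ) =>
      ψ (torusConv k (fun θ' => w (p.1, θ')) p.2) * f i p)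
      ((volume.restrict (Ioc 0 T)).prod (volume.restrict (cubeR d))) := fun i =>
    (integrable_torusConv (hki i).continuous (h.measurable_flux i) (h.integrable_flux i)).bdd_mul
      (hψc.measurable.comp hWm).aestronglyMeasurable (.of_forall fun p => hK _)
  have chain : ∀ θ ∈ cubeR d, Ψ (torusConv k (fun θ' => w (T, θ')) θ) - Ψ 0 =
      ∫ t in Ioc 0 T, ∑ i, ψ (torusConv k (fun θ' => w (t, θ')) θ) * f i (t, θ) := by
    intro θ hθ
    have hi : IntervalIntegrable (fun t => ∑ i, f i (t, θ)) volume 0 T := by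
      rw [intervalIntegrable_iff_integrableOn_Ioc_of_le hT.le]
      exact integrable_finsetSum _ fun i _ => integrable_torusConv_left (hki i).continuous
        (h.measurable_flux i) (h.integrable_flux i) hθ
    have := comp_integral_sub_eq_integral hi hΨ hK
    rw [← h.torusConv_eq_integral hkc hk.periodic θ ⟨hT.le, le_rfl⟩] at this
    rw [this, intervalIntegral.integral_of_le hT.le]
    refine setIntegral_congr_fun measurableSet_Ioc fun t ht => ?_
    rw [← h.torusConv_eq_integral hkc hk.periodic θ ⟨ht.1.le, ht.2⟩, Finset.mul_sum]
  have hWT : Continuous (torusConv k fun θ' => w (T, θ')) :=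
    continuous_torusConv hkc (h.integrableOn_slice T)
  have hΨT : Continuous fun θ => Ψ (torusConv k (fun θ' => w (T, θ')) θ) := by fun_prop
  calc (∫ θ in cubeR d, Ψ (torusConv k (fun θ' => w (T, θ')) θ)) - Ψ 0
      = ∫ θ in cubeR d, (Ψ (torusConv k (fun θ' => w (T, θ')) θ) - Ψ 0) := by
        rw [integral_sub hΨT.integrable_cubeR (integrable_const _)]
        simp
    _ = ∫ θ in cubeR d, ∫ t in Ioc 0 T,
          ∑ i, ψ (torusConv k (fun θ' => w (t, θ')) θ) * f i (t, θ) :=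
        setIntegral_congr_fun (measurableSet_cubeR d) chain
    _ = ∫ p, ∑ i, ψ (torusConv k (fun θ' => w (p.1, θ')) p.2) * f i p
          ∂((volume.restrict (Ioc 0 T)).prod (volume.restrict (cubeR d))) :=
        (integral_prod_symm _ (integrable_finsetSum _ fun i _ => hf1 i)).symm
    _ = ∑ i, ∫ p, ψ (torusConv k (fun θ' => w (p.1, θ')) p.2) * f i p
          ∂((volume.restrict (Ioc 0 T)).prod (volume.restrict (cubeR d))) :=
        integral_finsetSum _ fun i _ => hf1 i
    _ = _ := by
        rw [← Finset.sum_neg_distrib]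
        refine Finset.sum_congr rfl fun i _ => ?_
        have hi : Integrable (fun p : ℝ × (Fin d → ℝ) =>
            ψ' (torusConv k (fun θ' => w (p.1, θ')) p.2) *
            (torusConv k (fun θ' => g i (p.1, θ')) p.2 *
              torusConv k (fun θ' => F i (p.1, θ')) p.2))
            ((volume.restrict (Ioc 0 T)).prod (volume.restrict (cubeR d))) :=
          ((h.memLp_torusConv_grad hk i).integrable_mul (h.memLp_torusConv_flux hk i)).bdd_mul
            (hψ'.measurable.comp hWm).aestronglyMeasurable (.of_forall fun p => hM _)
        rw [integral_prod _ (hf1 i), integral_prod _ hi, ← integral_neg]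
        exact integral_congr_ae (h.integral_comp_torusConv_mul hkc hk.periodic hψ hψ' i)

lemma exists_seq_tendsto_torusConv {f f' : ℝ × (Fin d → ℝ) → ℝ} (ν : Measure ℝ)
    [IsFiniteMeasure ν] (hf : Measurable f) (hf1 : ∀ p, |f p| ≤ 1) (hf' : Measurable f')
    (hf1' : ∀ p, |f' p| ≤ 1) :
    ∃ ns : ℕ → ℕ, StrictMono ns ∧
      (∀ᵐ p ∂ν.prod (volume.restrict (cubeR d)), Tendsto (fun n =>
        torusConv (cosKernel d (ns n)) (fun θ' => f (p.1, θ')) p.2) atTop (𝓝 (f p))) ∧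
      ∀ᵐ p ∂ν.prod (volume.restrict (cubeR d)), Tendsto (fun n =>
        torusConv (cosKernel d (ns n)) (fun θ' => f' (p.1, θ')) p.2) atTop (𝓝 (f' p)) := by
  have hkc : ∀ n, Continuous (cosKernel d n) := fun n =>
    (isPeriodicMollifier_cosKernel d n).contDiff.continuous
  have key : ∀ f : ℝ × (Fin d → ℝ) → ℝ, Measurable f → (∀ p, |f p| ≤ 1) →
      TendstoInMeasure (ν.prod (volume.restrict (cubeR d))) (fun n p =>
        torusConv (cosKernel d n) (fun θ' => f (p.1, θ')) p.2) atTop f := fun f hf hf1 =>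
    tendstoInMeasure_of_tendsto_eLpNorm two_ne_zero
      (fun n => (measurable_torusConv (hkc n) hf).aestronglyMeasurable) hf.aestronglyMeasurable
      (tendsto_eLpNorm_torusConv_cosKernel ν hf
        (MemLp.of_bound hf.aestronglyMeasurable 1 (.of_forall hf1)))
  obtain ⟨ns, hns, h1⟩ := (key f hf hf1).exists_seq_tendsto_ae
  obtain ⟨ms, hms, h2⟩ := ((key f' hf' hf1').comp hns.tendsto_atTop).exists_seq_tendsto_ae
  refine ⟨ns ∘ ms, hns.comp hms, ?_, h2⟩
  filter_upwards [h1] with p hp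
  exact hp.comp hms.tendsto_atTop

/-- The entropy identity at the final time. -/
lemma integral_comp (h : IsWeakFluxSolution T w g F) (hT : 0 < T) {Ψ ψ ψ' : ℝ → ℝ} {K : NNReal}
    {M : ℝ} (hΨ : ∀ x, HasDerivAt Ψ (ψ x) x) (hψ : ∀ x, HasDerivAt ψ (ψ' x) x)
    (hψ' : Continuous ψ') (hK : ∀ x, |ψ x| ≤ K) (hM : ∀ x, |ψ' x| ≤ M) :
    (∫ θ in cubeR d, Ψ (w (T, θ))) - Ψ 0 =
      -∑ i, ∫ p, ψ' (w p) * (g i p * F i p)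
        ∂((volume.restrict (Ioc 0 T)).prod (volume.restrict (cubeR d))) := by
  set μ : Measure (Fin d → ℝ) := volume.restrict (cubeR d) with hμ
  set τ : Measure ℝ := volume.restrict (Ioc 0 T) with hτ
  have hk := isPeriodicMollifier_cosKernel d
  have hΨc : Continuous Ψ := continuous_iff_continuousAt.2 fun x => (hΨ x).continuousAt
  have hwT : Measurable fun p : ℝ × (Fin d → ℝ) => w (T, p.2) := h.measurable.comp (by fun_prop)
  obtain ⟨ns, hns, h1, h2⟩ := exists_seq_tendsto_torusConv τ h.measurable h.abs_le_one hwT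
    fun p => h.abs_le_one _
  have hT0 : τ ≠ 0 := by
    rw [hτ, Ne, Measure.restrict_eq_zero, Real.volume_Ioc]
    simpa using hT
  have : (ae τ).NeBot := ae_neBot.2 hT0
  have h2' : ∀ᵐ θ ∂μ, Tendsto (fun n =>
      torusConv (cosKernel d (ns n)) (fun θ' => w (T, θ')) θ) atTop (𝓝 (w (T, θ))) := by
    have := Measure.ae_ae_of_ae_prod h2
    exact this.exists.choose_spec
  obtain ⟨B, hB⟩ := (isCompact_Icc (a := (-1 : ℝ)) (b := 1)).exists_bound_of_continuousOn
    hΨc.continuousOn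
  have hleft : Tendsto (fun n => (∫ θ, Ψ (torusConv (cosKernel d (ns n))
      (fun θ' => w (T, θ')) θ) ∂μ) - Ψ 0) atTop (𝓝 ((∫ θ, Ψ (w (T, θ)) ∂μ) - Ψ 0)) := by
    refine Tendsto.sub_const ?_ _
    refine tendsto_integral_of_dominated_convergence (fun _ => B) (fun n => ?_)
      (integrable_const _) (fun n => .of_forall fun θ => hB _ ?_) ?_
    · exact (hΨc.comp (continuous_torusConv (hk (ns n)).contDiff
        (h.integrableOn_slice T))).aestronglyMeasurable
    · exact abs_le.1 ((hk (ns n)).abs_torusConv_le (fun θ' => h.abs_le_one _) θ)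
    · filter_upwards [h2'] with θ hθ
      exact (hΨc.tendsto _).comp hθ
  have hL2 : ∀ {f : ℝ × (Fin d → ℝ) → ℝ}, Measurable f → MemLp f 2 (τ.prod μ) →
      Tendsto (fun n => eLpNorm (fun p : ℝ × (Fin d → ℝ) =>
        torusConv (cosKernel d (ns n)) (fun θ' => f (p.1, θ')) p.2 - f p) 2 (τ.prod μ)) atTop
        (𝓝 0) := fun hf hf2 =>
    (tendsto_eLpNorm_torusConv_cosKernel τ hf hf2).comp hns.tendsto_atTop
  have hright := (tendsto_finsetSum Finset.univ fun i _ =>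
    tendsto_integral_mul_of_ae_of_L1 (m := τ.prod μ)
      (an := fun n p => ψ' (torusConv (cosKernel d (ns n)) (fun θ' => w (p.1, θ')) p.2))
      (a := fun p => ψ' (w p))
      (fun n => (hψ'.measurable.comp
        (h.measurable_torusConv_slice (hk (ns n)).contDiff.continuous)).aestronglyMeasurable)
      (fun n p => hM _) (by
        filter_upwards [h1] with p hp
        exact (hψ'.tendsto _).comp hp)
      ((h.memLp_grad i).integrable_mul (h.memLp_flux i))
      (fun n => (h.memLp_torusConv_grad (hk (ns n)) i).integrable_mul
        (h.memLp_torusConv_flux (hk (ns n)) i))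
      (tendsto_eLpNorm_mul_sub (h.memLp_grad i) (h.memLp_flux i)
        (fun n => h.memLp_torusConv_grad (hk (ns n)) i)
        (fun n => h.memLp_torusConv_flux (hk (ns n)) i)
        (hL2 (h.measurable_grad i) (h.memLp_grad i))
        (hL2 (h.measurable_flux i) (h.memLp_flux i)))).neg
  refine tendsto_nhds_unique hleft (hright.congr fun n => ?_)
  exact (h.integral_comp_torusConv hT (hk (ns n)) hΨ hψ hψ' hK hM).symm

end IsWeakFluxSolution

section SmoothAbs

variable {ε : ℝ}

lemma sqrt_sq_add_sq_pos (hε : 0 < ε) (x : ℝ) : 0 < √(x ^ 2 + ε ^ 2) :=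
  Real.sqrt_pos.2 (by positivity)

lemma hasDerivAt_sqrt_sq_add_sq (hε : 0 < ε) (x : ℝ) :
    HasDerivAt (fun x => √(x ^ 2 + ε ^ 2)) (x / √(x ^ 2 + ε ^ 2)) x := by
  have h := (((hasDerivAt_id x).pow 2).add_const (ε ^ 2)).sqrt
    (by simp only [id]; positivity : id x ^ 2 + ε ^ 2 ≠ 0)
  refine h.congr_deriv ?_
  simp [mul_div_mul_left]

lemma hasDerivAt_div_sqrt_sq_add_sq (hε : 0 < ε) (x : ℝ) :
    HasDerivAt (fun x => x / √(x ^ 2 + ε ^ 2)) (ε ^ 2 / √(x ^ 2 + ε ^ 2) ^ 3) x := by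
  have hs := sqrt_sq_add_sq_pos hε x
  refine ((hasDerivAt_id x).div (hasDerivAt_sqrt_sq_add_sq hε x) hs.ne').congr_deriv ?_
  have h2 : √(x ^ 2 + ε ^ 2) ^ 2 = x ^ 2 + ε ^ 2 := Real.sq_sqrt (by positivity)
  simp only [id]
  field_simp
  rw [h2]
  ring

lemma abs_le_sqrt_sq_add_sq (x : ℝ) : |x| ≤ √(x ^ 2 + ε ^ 2) :=
  Real.abs_le_sqrt (by nlinarith [sq_nonneg ε])

lemma le_sqrt_sq_add_sq (x : ℝ) : ε ≤ √(x ^ 2 + ε ^ 2) :=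
  Real.le_sqrt_of_sq_le (by nlinarith [sq_nonneg x])

lemma abs_div_sqrt_sq_add_sq_le (hε : 0 < ε) (x : ℝ) : |x / √(x ^ 2 + ε ^ 2)| ≤ 1 := by
  rw [abs_div, abs_of_pos (sqrt_sq_add_sq_pos hε x)]
  exact div_le_one_of_le₀ (abs_le_sqrt_sq_add_sq x) (Real.sqrt_nonneg _)

lemma abs_sq_div_sqrt_cube_le (hε : 0 < ε) (x : ℝ) :
    |ε ^ 2 / √(x ^ 2 + ε ^ 2) ^ 3| ≤ ε ^ 2 / ε ^ 3 := by
  rw [abs_of_nonneg (by positivity)]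
  have := le_sqrt_sq_add_sq (ε := ε) x
  gcongr

lemma sq_div_sqrt_cube_mul_abs_le (hε : 0 < ε) (x : ℝ) :
    ε ^ 2 / √(x ^ 2 + ε ^ 2) ^ 3 * |x| ≤ 1 := by
  have hs := sqrt_sq_add_sq_pos hε x
  rw [div_mul_eq_mul_div, div_le_one (pow_pos hs 3), pow_succ (√(x ^ 2 + ε ^ 2))]
  exact mul_le_mul (pow_le_pow_left₀ hε.le (le_sqrt_sq_add_sq x) 2) (abs_le_sqrt_sq_add_sq x)
    (abs_nonneg x) (sq_nonneg _)

lemma tendsto_sq_div_sqrt_cube_mul_abs (x : ℝ) {εn : ℕ → ℝ}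
    (hlim : Tendsto εn atTop (𝓝 0)) :
    Tendsto (fun n => εn n ^ 2 / √(x ^ 2 + εn n ^ 2) ^ 3 * |x|) atTop (𝓝 0) := by
  by_cases hx : x = 0
  · simp [hx]
  · have hden : Tendsto (fun n => √(x ^ 2 + εn n ^ 2) ^ 3) atTop (𝓝 (√(x ^ 2 + 0 ^ 2) ^ 3)) :=
      ((Real.continuous_sqrt.tendsto _).comp ((hlim.pow 2).const_add _)).pow 3
    have hne : √(x ^ 2 + 0 ^ 2) ^ 3 ≠ 0 := by
      have : 0 < √(x ^ 2 + 0 ^ 2) := Real.sqrt_pos.2 (by positivity)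
      positivity
    simpa using ((hlim.pow 2).div hden hne).mul_const |x|

end SmoothAbs

/-- A weak flux solution whose dissipation is controlled by `|w|` vanishes at the final time. -/
lemma IsWeakFluxSolution.ae_eq_zero {d : ℕ} {T : ℝ} {w : ℝ × (Fin d → ℝ) → ℝ}
    {g F : Fin d → ℝ × (Fin d → ℝ) → ℝ} (h : IsWeakFluxSolution T w g F) (hT : 0 < T)
    {H : ℝ × (Fin d → ℝ) → ℝ}
    (hH : Integrable H ((volume.restrict (Ioc 0 T)).prod (volume.restrict (cubeR d))))
    (hgF : ∀ p, -∑ i, g i p * F i p ≤ |w p| * H p) :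
    ∀ᵐ θ ∂volume.restrict (cubeR d), w (T, θ) = 0 := by
  set m := (volume.restrict (Ioc 0 T)).prod (volume.restrict (cubeR d)) with hm
  have hw : Integrable (fun θ => |w (T, θ)|) (volume.restrict (cubeR d)) :=
    (h.integrableOn_slice T).abs
  set a : ℝ → ℝ → ℝ := fun ε x => ε ^ 2 / √(x ^ 2 + ε ^ 2) ^ 3 with ha
  have hac : ∀ ε, 0 < ε → Continuous (a ε) := fun ε hε =>
    continuous_const.div (by fun_prop) fun x => (pow_pos (sqrt_sq_add_sq_pos hε x) 3).ne'
  have hbound : ∀ ε, 0 < ε →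
      ∫ θ in cubeR d, |w (T, θ)| ≤ ε + ∫ p, a ε (w p) * |w p| * H p ∂m := by
    intro ε hε
    have hsc : Continuous fun x => √(x ^ 2 + ε ^ 2) := by fun_prop
    have hid := h.integral_comp hT (Ψ := fun x => √(x ^ 2 + ε ^ 2)) (K := 1)
      (hasDerivAt_sqrt_sq_add_sq hε) (hasDerivAt_div_sqrt_sq_add_sq hε) (hac ε hε)
      (abs_div_sqrt_sq_add_sq_le hε) (abs_sq_div_sqrt_cube_le hε)
    have hi : ∀ i, Integrable (fun p => a ε (w p) * (g i p * F i p)) m := fun i =>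
      ((h.memLp_grad i).integrable_mul (h.memLp_flux i)).bdd_mul
        ((hac ε hε).measurable.comp h.measurable).aestronglyMeasurable
        (.of_forall fun p => abs_sq_div_sqrt_cube_le hε (w p))
    rw [← integral_finsetSum _ fun i _ => hi i, ← integral_neg] at hid
    have h0 : √((0 : ℝ) ^ 2 + ε ^ 2) = ε := by simp [Real.sqrt_sq hε.le]
    have h1 : ∫ θ in cubeR d, |w (T, θ)| ≤ ∫ θ in cubeR d, √(w (T, θ) ^ 2 + ε ^ 2) := by
      refine integral_mono hw ?_ fun θ => abs_le_sqrt_sq_add_sq _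
      refine Integrable.of_bound (hsc.measurable.comp
        (h.measurable.comp measurable_prodMk_left)).aestronglyMeasurable √(1 + ε ^ 2)
        (.of_forall fun θ => ?_)
      rw [Real.norm_of_nonneg (Real.sqrt_nonneg _)]
      have := (sq_le_one_iff_abs_le_one _).2 (h.abs_le_one (T, θ))
      gcongr
    have h2 : ∫ p, -∑ i, a ε (w p) * (g i p * F i p) ∂m ≤ ∫ p, a ε (w p) * |w p| * H p ∂m := by
      refine integral_mono (integrable_finsetSum _ fun i _ => hi i).neg ?_ fun p => ?_
      · refine hH.bdd_mul (c := 1) (((hac ε hε).measurable.comp h.measurable).mul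
          h.measurable.abs).aestronglyMeasurable (.of_forall fun p => ?_)
        rw [Real.norm_of_nonneg (by positivity)]
        exact sq_div_sqrt_cube_mul_abs_le hε _
      · dsimp only
        rw [← Finset.mul_sum, ← mul_neg, mul_assoc]
        exact mul_le_mul_of_nonneg_left (hgF p) (by positivity)
    linarith
  have hε0 : ∀ n : ℕ, (0 : ℝ) < 1 / (n + 1) := fun n => by positivity
  have hlim : Tendsto (fun n : ℕ => 1 / ((n : ℝ) + 1) +
      ∫ p, a (1 / (n + 1)) (w p) * |w p| * H p ∂m) atTop (𝓝 (0 + ∫ p, 0 * H p ∂m)) := by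
    refine tendsto_one_div_add_atTop_nhds_zero_nat.add ?_
    refine tendsto_integral_of_dominated_convergence (fun p => |H p|) (fun n => ?_) hH.abs
      (fun n => .of_forall fun p => ?_) (.of_forall fun p => ?_)
    · exact (((hac _ (hε0 n)).measurable.comp h.measurable).mul
          h.measurable.abs).aestronglyMeasurable.mul hH.1
    · rw [norm_mul, Real.norm_of_nonneg (by positivity), Real.norm_eq_abs]
      exact mul_le_of_le_one_left (abs_nonneg _) (sq_div_sqrt_cube_mul_abs_le (hε0 n) _)
    · exact (tendsto_sq_div_sqrt_cube_mul_abs (w p)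
        tendsto_one_div_add_atTop_nhds_zero_nat).mul_const _
  have hle : ∫ θ in cubeR d, |w (T, θ)| ≤ 0 := by
    simpa using ge_of_tendsto' hlim fun n => hbound _ (hε0 n)
  have hz := (integral_eq_zero_iff_of_nonneg (fun θ => abs_nonneg (w (T, θ))) hw).1
    (le_antisymm hle (integral_nonneg fun θ => abs_nonneg _))
  filter_upwards [hz] with θ hθ
  simpa using hθ

section Coefficients

variable {d : ℕ}

lemma sum_mul_sum_sub_eq (A B : Matrix (Fin d) (Fin d) ℝ) (p q : Fin d → ℝ) :
    ∑ i, (p i - q i) * (∑ j, A i j * p j - ∑ j, B i j * q j) =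
      (p - q) ⬝ᵥ A.mulVec (p - q) + ∑ i, (p i - q i) * ∑ j, (A i j - B i j) * q j := by
  simp only [dotProduct, mulVec, Pi.sub_apply, ← Finset.sum_add_distrib, ← mul_add,
    ← Finset.sum_sub_distrib]
  refine Finset.sum_congr rfl fun i _ => ?_
  congr 1
  refine Finset.sum_congr rfl fun j _ => ?_
  ring

/-- The dissipation is bounded below by the discrepancy of the coefficients. -/
lemma neg_sum_mul_flux_sub_le {c δ : ℝ} (hc : 0 < c) {A B : Matrix (Fin d) (Fin d) ℝ}
    (hA : ∀ ξ : Fin d → ℝ, c * (∑ i, ξ i ^ 2) ≤ ξ ⬝ᵥ A.mulVec ξ)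
    (hAB : ∀ i j, (A i j - B i j) ^ 2 ≤ δ) (p q : Fin d → ℝ) :
    -∑ i, (p i - q i) * (∑ j, A i j * p j - ∑ j, B i j * q j) ≤
      d ^ 2 * δ / (4 * c) * ∑ j, q j ^ 2 := by
  rw [sum_mul_sum_sub_eq]
  have h1 := hA (p - q)
  have h2 : ∀ i, (∑ j, (A i j - B i j) * q j) ^ 2 ≤ d * δ * ∑ j, q j ^ 2 := by
    intro i
    refine (Finset.sum_mul_sq_le_sq_mul_sq _ _ _).trans ?_
    refine mul_le_mul_of_nonneg_right ?_ (Finset.sum_nonneg fun j _ => sq_nonneg _)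
    simpa using Finset.sum_le_sum fun j (_ : j ∈ Finset.univ) => hAB i j
  have h3 : ∀ i, -((p i - q i) * ∑ j, (A i j - B i j) * q j) ≤
      c * (p i - q i) ^ 2 + d * δ * (∑ j, q j ^ 2) / (4 * c) := by
    intro i
    have hsq : (∑ j, (A i j - B i j) * q j) ^ 2 / (4 * c) ≤
        d * δ * (∑ j, q j ^ 2) / (4 * c) := by
      have := h2 i
      gcongr
    refine le_trans ?_ (add_le_add_right hsq _)
    rw [← sub_nonneg]
    have : c * (p i - q i) ^ 2 + (∑ j, (A i j - B i j) * q j) ^ 2 / (4 * c) -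
        -((p i - q i) * ∑ j, (A i j - B i j) * q j) =
        (2 * c * (p i - q i) + ∑ j, (A i j - B i j) * q j) ^ 2 / (4 * c) := by
      field_simp
      ring
    rw [this]
    positivity
  have h4 := Finset.sum_le_sum fun i (_ : i ∈ Finset.univ) => h3 i
  rw [Finset.sum_neg_distrib, Finset.sum_add_distrib, ← Finset.mul_sum] at h4
  simp only [Finset.sum_const, Finset.card_univ, Fintype.card_fin, nsmul_eq_mul] at h4
  simp only [Pi.sub_apply] at h1
  have h5 : (d : ℝ) * (d * δ * (∑ j, q j ^ 2) / (4 * c)) =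
      d ^ 2 * δ / (4 * c) * ∑ j, q j ^ 2 := by ring
  linarith

lemma abs_apply_le_of_elliptic {c : ℝ} (hc : 0 < c) {A : Matrix (Fin d) (Fin d) ℝ}
    (hs : A.IsSymm) (hA : ∀ ξ : Fin d → ℝ, c * (∑ i, ξ i ^ 2) ≤ ξ ⬝ᵥ A.mulVec ξ ∧
      ξ ⬝ᵥ A.mulVec ξ ≤ c⁻¹ * ∑ i, ξ i ^ 2) (i j : Fin d) : |A i j| ≤ 2 * c⁻¹ := by
  have hdiag : ∀ i, 0 ≤ A i i ∧ A i i ≤ c⁻¹ := by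
    intro i
    have := hA (Pi.single i 1)
    simp [Pi.single_apply] at this
    exact ⟨hc.le.trans this.1, this.2⟩
  have hsq : ∑ l, (Pi.single i (1 : ℝ) + Pi.single j 1 : Fin d → ℝ) l ^ 2 ≤ 4 := by
    calc ∑ l, (Pi.single i (1 : ℝ) + Pi.single j 1 : Fin d → ℝ) l ^ 2
        ≤ ∑ l, 2 * ((Pi.single i (1 : ℝ) : Fin d → ℝ) l ^ 2
            + (Pi.single j (1 : ℝ) : Fin d → ℝ) l ^ 2) :=
          Finset.sum_le_sum fun l _ => by
            simp only [Pi.add_apply]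
            exact add_sq_le
      _ = 4 := by
          simp [← Finset.mul_sum, Finset.sum_add_distrib, Pi.single_apply]
          norm_num
  have h := hA (Pi.single i 1 + Pi.single j 1)
  have hQ : (Pi.single i (1 : ℝ) + Pi.single j 1) ⬝ᵥ A.mulVec (Pi.single i 1 + Pi.single j 1) =
      A i i + A j j + 2 * A i j := by
    simp [mulVec_add, add_dotProduct, dotProduct_add]
    rw [hs.apply i j]
    ring
  have hc' : 0 < c⁻¹ := inv_pos.2 hc
  rw [hQ] at h
  have h1 : 0 ≤ A i i + A j j + 2 * A i j :=
    (mul_nonneg hc.le (Finset.sum_nonneg fun l _ => sq_nonneg _)).trans h.1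
  have h2 := h.2.trans (mul_le_mul_of_nonneg_left hsq hc'.le)
  obtain ⟨hi, hi'⟩ := hdiag i
  obtain ⟨hj, hj'⟩ := hdiag j
  rw [abs_le]
  constructor <;> linarith

/-- The dissipation of the difference of two solutions is controlled by their distance. -/
lemma neg_sum_mul_flux_sub_le_abs_mul {c C : ℝ} (hc : 0 < c)
    {D : ℝ → Matrix (Fin d) (Fin d) ℝ}
    (hell : ∀ x ∈ Icc (0 : ℝ) 1, ∀ ξ : Fin d → ℝ, c * (∑ i, ξ i ^ 2) ≤ ξ ⬝ᵥ (D x).mulVec ξ)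
    (hC : 0 ≤ C)
    (hreg : ∀ x ∈ Ioo (0 : ℝ) 1, ∀ y ∈ Icc (0 : ℝ) 1, ∀ i j,
      (D x i j - D y i j) ^ 2 ≤ C * (x * (1 - x))⁻¹ * |x - y|)
    {a b : ℝ} (ha : a ∈ Icc (0 : ℝ) 1) (hb : b ∈ Icc (0 : ℝ) 1) (p q : Fin d → ℝ) :
    -∑ i, (p i - q i) * (∑ j, D a i j * p j - ∑ j, D b i j * q j) ≤
      |a - b| * (d ^ 2 * C / (4 * c) *
        ((∑ j, p j ^ 2) / (a * (1 - a)) + (∑ j, q j ^ 2) / (b * (1 - b))) +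
        |∑ i, (p i - q i) * (∑ j, D a i j * p j - ∑ j, D b i j * q j)|) := by
  set S := ∑ i, (p i - q i) * (∑ j, D a i j * p j - ∑ j, D b i j * q j) with hS
  have ha1 : 0 ≤ 1 - a := sub_nonneg.2 ha.2
  have hb1 : 0 ≤ 1 - b := sub_nonneg.2 hb.2
  have ha0 := ha.1
  have hb0 := hb.1
  have hP : 0 ≤ (∑ j, p j ^ 2) / (a * (1 - a)) := by positivity
  have hQ : 0 ≤ (∑ j, q j ^ 2) / (b * (1 - b)) := by positivity
  have hK : 0 ≤ d ^ 2 * C / (4 * c) := by positivity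
  have hle : ∀ R, R ≤ (∑ j, p j ^ 2) / (a * (1 - a)) + (∑ j, q j ^ 2) / (b * (1 - b)) →
      |a - b| * (d ^ 2 * C / (4 * c) * R) ≤ |a - b| * (d ^ 2 * C / (4 * c) *
        ((∑ j, p j ^ 2) / (a * (1 - a)) + (∑ j, q j ^ 2) / (b * (1 - b))) + |S|) := by
    intro R hR
    refine mul_le_mul_of_nonneg_left ?_ (abs_nonneg _)
    exact (mul_le_mul_of_nonneg_left hR hK).trans (le_add_of_nonneg_right (abs_nonneg _))
  by_cases hbI : b ∈ Ioo (0 : ℝ) 1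
  · have h := neg_sum_mul_flux_sub_le hc (hell a ha) (B := D b)
      (fun i j => by rw [sub_sq_comm]; exact hreg b hbI a ha i j) p q
    refine h.trans (le_trans (le_of_eq ?_) (hle _ (le_add_of_nonneg_left hP)))
    rw [abs_sub_comm]
    ring
  by_cases haI : a ∈ Ioo (0 : ℝ) 1
  · have h := neg_sum_mul_flux_sub_le hc (hell b hb) (B := D a)
      (fun i j => by rw [sub_sq_comm]; exact hreg a haI b hb i j) q p
    have hS' : ∑ i, (q i - p i) * (∑ j, D b i j * q j - ∑ j, D a i j * p j) = S :=
      Finset.sum_congr rfl fun i _ => by ring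
    rw [hS'] at h
    refine h.trans (le_trans (le_of_eq ?_) (hle _ (le_add_of_nonneg_right hQ)))
    ring
  have hend : ∀ x ∈ Icc (0 : ℝ) 1, x ∉ Ioo (0 : ℝ) 1 → x = 0 ∨ x = 1 := by
    intro x hx hx'
    by_contra! hne
    exact hx' ⟨lt_of_le_of_ne hx.1 hne.1.symm, lt_of_le_of_ne hx.2 hne.2⟩
  by_cases hab : a = b
  · have h := neg_sum_mul_flux_sub_le (δ := 0) hc (hell a ha) (B := D b)
      (fun i j => by simp [hab]) p q
    rw [← hS] at h
    simpa [hab] using h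
  · have h1 : |a - b| = 1 := by
      rcases hend a ha haI with rfl | rfl <;> rcases hend b hb hbI with rfl | rfl <;> simp_all
    rw [h1, one_mul]
    exact (neg_le_abs S).trans (le_add_of_nonneg_left (by positivity))

end Coefficients

section SpaceTime

variable {d : ℕ} {T : ℝ}

lemma restrict_QT_eq_prod (d : ℕ) (T : ℝ) : (volume.restrict (QT d T)) =
    (volume.restrict (Ioc 0 T)).prod (volume.restrict (cubeR d)) := by
  rw [QT, Measure.prod_restrict, Measure.volume_eq_prod]

lemma Continuous.integrable_mul_QT {ζ f : ℝ × (Fin d → ℝ) → ℝ} (hζ : Continuous ζ)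
    (hf : IntegrableOn f (QT d T)) : IntegrableOn (fun p => ζ p * f p) (QT d T) := by
  obtain ⟨B, hB⟩ := (isCompact_Icc.prod isCompact_Icc :
    IsCompact (Icc (0 : ℝ) T ×ˢ Icc (0 : Fin d → ℝ) 1)).exists_bound_of_continuousOn
    hζ.continuousOn
  refine Integrable.bdd_mul (c := B) hf hζ.aestronglyMeasurable ?_
  filter_upwards [ae_restrict_mem (measurableSet_Ioc.prod (measurableSet_cubeR d))] with p hp
  exact hB p ⟨Ioc_subset_Icc_self hp.1, fun i => (hp.2 i trivial).1,
    fun i => (hp.2 i trivial).2.le⟩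

end SpaceTime

namespace IsWeakSolution

variable {d : ℕ} {T : ℝ} {D : ℝ → Matrix (Fin d) (Fin d) ℝ} {u : ℝ → (Fin d → ℝ) → ℝ}
  {g : ℝ → (Fin d → ℝ) → Fin d → ℝ}

lemma measurable (h : IsWeakSolution d T D u g) :
    Measurable fun p : ℝ × (Fin d → ℝ) => u p.1 p.2 := h.1

lemma mem_Icc (h : IsWeakSolution d T D u g) (t : ℝ) (θ : Fin d → ℝ) : u t θ ∈ Icc (0 : ℝ) 1 :=
  h.2.1 t θ

lemma measurable_grad (h : IsWeakSolution d T D u g) (i : Fin d) :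
    Measurable fun p : ℝ × (Fin d → ℝ) => g p.1 p.2 i :=
  (measurable_pi_apply i).comp h.2.2.2.2.1

lemma memLp_grad (h : IsWeakSolution d T D u g) (i : Fin d) :
    MemLp (fun p : ℝ × (Fin d → ℝ) => g p.1 p.2 i) 2 (volume.restrict (QT d T)) := by
  rw [memLp_two_iff_integrable_sq (h.measurable_grad i).aestronglyMeasurable]
  refine Integrable.mono' h.2.2.2.2.2.1 ((h.measurable_grad i).pow_const 2).aestronglyMeasurable
    (.of_forall fun p => ?_)
  rw [Real.norm_of_nonneg (sq_nonneg _)]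
  exact Finset.single_le_sum (f := fun i => g p.1 p.2 i ^ 2) (fun j _ => sq_nonneg _)
    (Finset.mem_univ i)

lemma integrableOn (h : IsWeakSolution d T D u g) :
    IntegrableOn (fun p : ℝ × (Fin d → ℝ) => u p.1 p.2) (QT d T) := by
  rw [IntegrableOn, restrict_QT_eq_prod]
  exact Integrable.of_bound h.measurable.aestronglyMeasurable 1 (.of_forall fun p => by
    rw [Real.norm_of_nonneg (h.mem_Icc _ _).1]
    exact (h.mem_Icc _ _).2)

lemma measurable_flux (h : IsWeakSolution d T D u g)
    (hDm : ∀ i j, Measurable fun x => D x i j) (i : Fin d) :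
    Measurable fun p : ℝ × (Fin d → ℝ) => ∑ j, D (u p.1 p.2) i j * g p.1 p.2 j :=
  Finset.measurable_fun_sum _ fun j _ => ((hDm i j).comp h.measurable).mul (h.measurable_grad j)

lemma memLp_flux (h : IsWeakSolution d T D u g) (hDm : ∀ i j, Measurable fun x => D x i j)
    {B : ℝ} (hB : ∀ x ∈ Icc (0 : ℝ) 1, ∀ i j, |D x i j| ≤ B) (i : Fin d) :
    MemLp (fun p : ℝ × (Fin d → ℝ) => ∑ j, D (u p.1 p.2) i j * g p.1 p.2 j) 2
      (volume.restrict (QT d T)) :=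
  memLp_finsetSum _ fun j _ => (h.memLp_grad j).of_le_mul (c := B)
    (((hDm i j).comp h.measurable).mul (h.measurable_grad j)).aestronglyMeasurable
    (.of_forall fun p => by
      rw [norm_mul]
      exact mul_le_mul_of_nonneg_right (hB _ (h.mem_Icc _ _) i j) (norm_nonneg _))

/-- The weak gradient tested against a product of functions of time and space. -/
lemma integral_mul_fderiv (h : IsWeakSolution d T D u g) {η : ℝ → ℝ} (hη : ContDiff ℝ ∞ η)
    {φ : (Fin d → ℝ) → ℝ} (hφ : ContDiff ℝ ∞ φ) (hp : SpacePeriodic φ) (i : Fin d) :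
    ∫ p in QT d T, η p.1 * fderiv ℝ φ p.2 (Pi.single i 1) * u p.1 p.2 =
      -∫ p in QT d T, η p.1 * φ p.2 * g p.1 p.2 i := by
  have hΦ : ContDiff ℝ ∞ fun p : ℝ × (Fin d → ℝ) =>
      (Pi.single i (η p.1 * φ p.2) : Fin d → ℝ) := by
    rw [contDiff_pi]
    intro j
    by_cases hj : j = i
    · subst hj
      simp only [Pi.single_eq_same]
      fun_prop
    · simp only [Pi.single_eq_of_ne hj]
      fun_prop
  have key := h.2.2.2.2.2.2.1 _ hΦ fun t θ l j => by
    have := hp θ l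
    simp only [this]
  have h1 : ∀ p : ℝ × (Fin d → ℝ), ∑ j, fderiv ℝ (fun θ =>
      (Pi.single i (η p.1 * φ θ) : Fin d → ℝ) j) p.2 (Pi.single j 1) =
      η p.1 * fderiv ℝ φ p.2 (Pi.single i 1) := by
    intro p
    rw [Finset.sum_eq_single i]
    · simp only [Pi.single_eq_same]
      rw [fderiv_const_mul (hφ.differentiable (by simp) _)]
      simp
    · intro j _ hj
      simp [Pi.single_eq_of_ne hj]
    · simp
  simp only [h1] at key
  have h2 : ∀ p : ℝ × (Fin d → ℝ), ∑ j, g p.1 p.2 j * (Pi.single i (η p.1 * φ p.2) : Fin d → ℝ) j =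
      η p.1 * φ p.2 * g p.1 p.2 i := by
    intro p
    rw [Finset.sum_eq_single i]
    · simp [mul_comm]
    · intro j _ hj
      simp [Pi.single_eq_of_ne hj]
    · simp
  simp only [h2] at key
  simpa only [mul_comm] using key

/-- The equation tested against a product of functions of time and space. -/
lemma integral_final_sub_initial (h : IsWeakSolution d T D u g) {η : ℝ → ℝ}
    (hη : ContDiff ℝ ∞ η) {φ : (Fin d → ℝ) → ℝ} (hφ : ContDiff ℝ ∞ φ) (hp : SpacePeriodic φ) :
    η T * (∫ θ in cubeR d, φ θ * u T θ) - η 0 * ∫ θ in cubeR d, φ θ * u 0 θ =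
      (∫ p in QT d T, deriv η p.1 * φ p.2 * u p.1 p.2) -
        ∫ p in QT d T, ∑ i, η p.1 * fderiv ℝ φ p.2 (Pi.single i 1) *
          ∑ j, D (u p.1 p.2) i j * g p.1 p.2 j := by
  have key := h.2.2.2.2.2.2.2.2 (fun p => η p.1 * φ p.2) (by fun_prop) fun t θ i => by
    have := hp θ i
    simp only [this]
  have h1 : ∀ (t : ℝ) (θ : Fin d → ℝ), deriv (fun s => η s * φ θ) t = deriv η t * φ θ :=
    fun t θ => deriv_mul_const (hη.differentiable (by simp) _) _
  have h2 : ∀ (t : ℝ) (θ v : Fin d → ℝ),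
      fderiv ℝ (fun θ => η t * φ θ) θ v = η t * fderiv ℝ φ θ v := by
    intro t θ v
    rw [fderiv_const_mul (hφ.differentiable (by simp) _)]
    simp
  simp only [h1, h2] at key
  simpa only [Finset.mul_sum, ← integral_const_mul, ← mul_assoc] using key

end IsWeakSolution

/-- The difference of two weak solutions with the same initial data is a weak flux solution. -/
lemma IsWeakSolution.isWeakFluxSolution_sub {d : ℕ} {T : ℝ} (hT : 0 < T)
    {D : ℝ → Matrix (Fin d) (Fin d) ℝ} (hDm : ∀ i j, Measurable fun x => D x i j) {B : ℝ}
    (hB : ∀ x ∈ Icc (0 : ℝ) 1, ∀ i j, |D x i j| ≤ B)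
    {u₁ u₂ : ℝ → (Fin d → ℝ) → ℝ} {g₁ g₂ : ℝ → (Fin d → ℝ) → Fin d → ℝ}
    (h₁ : IsWeakSolution d T D u₁ g₁) (h₂ : IsWeakSolution d T D u₂ g₂)
    (hinit : ∀ᵐ θ ∂volume.restrict (cubeR d), u₁ 0 θ = u₂ 0 θ) :
    IsWeakFluxSolution T (fun p : ℝ × (Fin d → ℝ) => u₁ p.1 p.2 - u₂ p.1 p.2)
      (fun i p => g₁ p.1 p.2 i - g₂ p.1 p.2 i)
      (fun i p => ∑ j, D (u₁ p.1 p.2) i j * g₁ p.1 p.2 j -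
        ∑ j, D (u₂ p.1 p.2) i j * g₂ p.1 p.2 j) := by
  have hg : ∀ i, MemLp (fun p : ℝ × (Fin d → ℝ) => g₁ p.1 p.2 i - g₂ p.1 p.2 i) 2
      (volume.restrict (QT d T)) := fun i => (h₁.memLp_grad i).sub (h₂.memLp_grad i)
  have hF : ∀ i, MemLp (fun p : ℝ × (Fin d → ℝ) => ∑ j, D (u₁ p.1 p.2) i j * g₁ p.1 p.2 j -
        ∑ j, D (u₂ p.1 p.2) i j * g₂ p.1 p.2 j) 2 (volume.restrict (QT d T)) := fun i =>
    (h₁.memLp_flux hDm hB i).sub (h₂.memLp_flux hDm hB i)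
  have hu : IntegrableOn (fun p : ℝ × (Fin d → ℝ) => u₁ p.1 p.2 - u₂ p.1 p.2) (QT d T) :=
    h₁.integrableOn.sub h₂.integrableOn
  have hfin : IsFiniteMeasure (volume.restrict (QT d T)) := by
    rw [restrict_QT_eq_prod]
    infer_instance
  have hcube : ∀ {u : ℝ → (Fin d → ℝ) → ℝ} {g : ℝ → (Fin d → ℝ) → Fin d → ℝ},
      IsWeakSolution d T D u g → ∀ {φ : (Fin d → ℝ) → ℝ}, Continuous φ → ∀ t,
      IntegrableOn (fun θ => φ θ * u t θ) (cubeR d) := fun h φ hφ t =>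
    hφ.integrable_cubeR.mul_bdd (c := 1)
      (h.measurable.comp measurable_prodMk_left).aestronglyMeasurable (.of_forall fun θ => by
        rw [Real.norm_of_nonneg (h.mem_Icc _ _).1]
        exact (h.mem_Icc _ _).2)
  refine ⟨h₁.measurable.sub h₂.measurable, fun p => ?_,
    fun i => (h₁.measurable_grad i).sub (h₂.measurable_grad i),
    fun i => (h₁.measurable_flux hDm i).sub (h₂.measurable_flux hDm i), fun i => ?_, fun i => ?_,
    fun φ hφ hp i => ?_, fun φ hφ hp => ?_⟩
  · have ha := h₁.mem_Icc p.1 p.2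
    have hb := h₂.mem_Icc p.1 p.2
    exact abs_le.2 ⟨by linarith [ha.1, hb.2], by linarith [ha.2, hb.1]⟩
  · rw [← restrict_QT_eq_prod]
    exact hg i
  · rw [← restrict_QT_eq_prod]
    exact hF i
  · have hφi : Continuous fun p : ℝ × (Fin d → ℝ) => fderiv ℝ φ p.2 (Pi.single i 1) :=
      (fderiv_single_contDiff hφ i).continuous.comp continuous_snd
    have hφc : Continuous fun p : ℝ × (Fin d → ℝ) => φ p.2 := hφ.continuous.comp continuous_snd
    have iw := hφi.integrable_mul_QT hu
    have ig := hφc.integrable_mul_QT ((hg i).integrable (by norm_num))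
    have iwg := iw.add ig
    simp only [IntegrableOn, restrict_QT_eq_prod] at iwg
    have hzero := ae_eq_zero_of_integral_smooth_mul_eq_zero hT
      (c := fun t => ∫ θ in cubeR d, (fderiv ℝ φ θ (Pi.single i 1) * (u₁ t θ - u₂ t θ) +
        φ θ * (g₁ t θ i - g₂ t θ i)))
      ((intervalIntegrable_iff_integrableOn_Ioc_of_le hT.le).2 iwg.integral_prod_left)
      fun η hη => ?_
    · have iw' := iw
      have ig' := ig
      simp only [IntegrableOn, restrict_QT_eq_prod] at iw' ig'
      filter_upwards [hzero, iw'.prod_right_ae, ig'.prod_right_ae] with t ht hit hit'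
      rw [integral_add hit hit'] at ht
      simp only [mul_comm _ (φ _), mul_comm _ (fderiv ℝ φ _ _)]
      exact eq_neg_of_add_eq_zero_left ht
    · have hηc : Continuous fun p : ℝ × (Fin d → ℝ) => η p.1 := hη.continuous.comp continuous_fst
      have k1 := h₁.integral_mul_fderiv hη hφ hp i
      have k2 := h₂.integral_mul_fderiv hη hφ hp i
      have hηφi : Continuous fun p : ℝ × (Fin d → ℝ) =>
        η p.1 * fderiv ℝ φ p.2 (Pi.single i 1) := hηc.mul hφi
      have hηφ : Continuous fun p : ℝ × (Fin d → ℝ) => η p.1 * φ p.2 := hηc.mul hφc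
      have e1 := hηφi.integrable_mul_QT h₁.integrableOn
      have e2 := hηφi.integrable_mul_QT h₂.integrableOn
      have e3 := hηφ.integrable_mul_QT ((h₁.memLp_grad i).integrable (by norm_num))
      have e4 := hηφ.integrable_mul_QT ((h₂.memLp_grad i).integrable (by norm_num))
      have hi := hηc.integrable_mul_QT (iw.add ig)
      rw [IntegrableOn, restrict_QT_eq_prod] at hi
      calc _ = ∫ p in QT d T, η p.1 * (fderiv ℝ φ p.2 (Pi.single i 1) *
              (u₁ p.1 p.2 - u₂ p.1 p.2) + φ p.2 * (g₁ p.1 p.2 i - g₂ p.1 p.2 i)) := by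
            rw [intervalIntegral.integral_of_le hT.le, restrict_QT_eq_prod]
            refine Eq.trans ?_ (integral_prod _ hi).symm
            simp only [integral_const_mul]
            rfl
        _ = ∫ p in QT d T, ((η p.1 * fderiv ℝ φ p.2 (Pi.single i 1) * u₁ p.1 p.2 +
              η p.1 * φ p.2 * g₁ p.1 p.2 i) - (η p.1 * fderiv ℝ φ p.2 (Pi.single i 1) *
              u₂ p.1 p.2 + η p.1 * φ p.2 * g₂ p.1 p.2 i)) := by
            congr 1
            ext p
            ring
        _ = 0 := by
            refine (integral_sub (e1.add e3) (e2.add e4)).trans ?_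
            refine (congrArg₂ (· - ·) (integral_add e1 e3) (integral_add e2 e4)).trans ?_
            rw [k1, k2]
            ring
  · set a : ℝ → ℝ := fun t => (∫ θ in cubeR d, φ θ * u₁ t θ) - ∫ θ in cubeR d, φ θ * u₂ t θ
      with ha
    have hac : Continuous a := (h₁.2.2.2.1 φ hφ hp).sub (h₂.2.2.2.1 φ hφ hp)
    have ha0 : a 0 = 0 := by
      rw [ha, sub_eq_zero]
      refine integral_congr_ae ?_
      filter_upwards [hinit] with θ hθ
      rw [hθ]
    have haw : ∀ t, a t = ∫ θ in cubeR d, φ θ * (u₁ t θ - u₂ t θ) := by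
      intro t
      simp only [mul_sub]
      exact (integral_sub (hcube h₁ hφ.continuous t) (hcube h₂ hφ.continuous t)).symm
    have hφc : Continuous fun p : ℝ × (Fin d → ℝ) => φ p.2 := hφ.continuous.comp continuous_snd
    have hφi : ∀ i, Continuous fun p : ℝ × (Fin d → ℝ) => fderiv ℝ φ p.2 (Pi.single i 1) :=
      fun i => (fderiv_single_contDiff hφ i).continuous.comp continuous_snd
    have iF := integrable_finsetSum Finset.univ fun i _ =>
      (hφi i).integrable_mul_QT ((hF i).integrable (by norm_num))
    have iF' := iF
    simp only [restrict_QT_eq_prod] at iF'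
    have key := eq_neg_integral_of_weak_deriv hT hac
      ((intervalIntegrable_iff_integrableOn_Ioc_of_le hT.le).2 iF'.integral_prod_left)
      fun η hη => ?_
    · intro t ht
      rw [← haw, key t ht]
    · have hηc : Continuous fun p : ℝ × (Fin d → ℝ) => η p.1 := hη.continuous.comp continuous_fst
      have hη'c : Continuous fun p : ℝ × (Fin d → ℝ) => deriv η p.1 :=
        (hη.continuous_deriv (by simp)).comp continuous_fst
      have k1 := h₁.integral_final_sub_initial hη hφ hp
      have k2 := h₂.integral_final_sub_initial hη hφ hp
      have hη'φ : Continuous fun p : ℝ × (Fin d → ℝ) => deriv η p.1 * φ p.2 := hη'c.mul hφc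
      have hηφi : ∀ i, Continuous fun p : ℝ × (Fin d → ℝ) =>
        η p.1 * fderiv ℝ φ p.2 (Pi.single i 1) := fun i => hηc.mul (hφi i)
      have e1 := hη'φ.integrable_mul_QT h₁.integrableOn
      have e2 := hη'φ.integrable_mul_QT h₂.integrableOn
      have e3 := integrable_finsetSum Finset.univ fun i _ =>
        (hηφi i).integrable_mul_QT ((h₁.memLp_flux hDm hB i).integrable (by norm_num))
      have e4 := integrable_finsetSum Finset.univ fun i _ =>
        (hηφi i).integrable_mul_QT ((h₂.memLp_flux hDm hB i).integrable (by norm_num))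
      have hi := hηc.integrable_mul_QT iF
      have hi' := hη'c.integrable_mul_QT
        (hφc.integrable_mul_QT hu)
      rw [IntegrableOn, restrict_QT_eq_prod] at hi hi'
      have s1 : ∫ t in (0 : ℝ)..T, deriv η t * a t =
          (∫ p in QT d T, deriv η p.1 * φ p.2 * u₁ p.1 p.2) -
            ∫ p in QT d T, deriv η p.1 * φ p.2 * u₂ p.1 p.2 := by
        rw [← integral_sub e1 e2, intervalIntegral.integral_of_le hT.le]
        simp only [haw, ← integral_const_mul]
        refine (integral_prod _ hi').symm.trans ?_
        rw [← restrict_QT_eq_prod]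
        congr 1
        ext p
        ring
      have s2 : ∫ t in (0 : ℝ)..T, η t * (∫ θ in cubeR d, ∑ i, fderiv ℝ φ θ (Pi.single i 1) *
          (∑ j, D (u₁ t θ) i j * g₁ t θ j - ∑ j, D (u₂ t θ) i j * g₂ t θ j)) =
          (∫ p in QT d T, ∑ i, η p.1 * fderiv ℝ φ p.2 (Pi.single i 1) *
            ∑ j, D (u₁ p.1 p.2) i j * g₁ p.1 p.2 j) -
            ∫ p in QT d T, ∑ i, η p.1 * fderiv ℝ φ p.2 (Pi.single i 1) *
              ∑ j, D (u₂ p.1 p.2) i j * g₂ p.1 p.2 j := by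
        rw [← integral_sub e3 e4, intervalIntegral.integral_of_le hT.le]
        simp only [← integral_const_mul]
        refine (integral_prod _ hi).symm.trans ?_
        rw [← restrict_QT_eq_prod]
        congr 1
        ext p
        rw [Finset.mul_sum, ← Finset.sum_sub_distrib]
        refine Finset.sum_congr rfl fun i _ => ?_
        ring
      have h0 : (∫ θ in cubeR d, φ θ * u₁ 0 θ) = ∫ θ in cubeR d, φ θ * u₂ 0 θ :=
        sub_eq_zero.1 ha0
      rw [s1, s2, ha, mul_sub]
      rw [h0] at k1
      linarith

theorem stmt_12 (d : ℕ) (hd : 0 < d) (T : ℝ) (hT : 0 < T) (c C : ℝ) (hc : 0 < c)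
    (D : ℝ → Matrix (Fin d) (Fin d) ℝ) (hDm : ∀ i j, Measurable fun x => D x i j)
    (hDsymm : ∀ x ∈ Set.Icc (0 : ℝ) 1, (D x).IsSymm)
    (hell : ∀ x ∈ Set.Icc (0 : ℝ) 1, ∀ ξ : Fin d → ℝ,
      c * (∑ i, ξ i ^ 2) ≤ ξ ⬝ᵥ (D x).mulVec ξ ∧
        ξ ⬝ᵥ (D x).mulVec ξ ≤ c⁻¹ * ∑ i, ξ i ^ 2)
    (hreg : ∀ x ∈ Set.Ioo (0 : ℝ) 1, ∀ y ∈ Set.Icc (0 : ℝ) 1, ∀ i j,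
      (D x i j - D y i j) ^ 2 ≤ C * (x * (1 - x))⁻¹ * |x - y|)
    (u₁ u₂ : ℝ → (Fin d → ℝ) → ℝ) (g₁ g₂ : ℝ → (Fin d → ℝ) → Fin d → ℝ)
    (h₁ : IsWeakSolution d T D u₁ g₁) (h₂ : IsWeakSolution d T D u₂ g₂)
    (hinit : ∀ᵐ θ ∂volume.restrict (cubeR d), u₁ 0 θ = u₂ 0 θ) :
    ∀ᵐ p ∂volume.restrict (QT d T), u₁ p.1 p.2 = u₂ p.1 p.2 := by
  have hell' : ∀ x ∈ Icc (0 : ℝ) 1, ∀ ξ : Fin d → ℝ,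
      c * (∑ i, ξ i ^ 2) ≤ ξ ⬝ᵥ (D x).mulVec ξ := fun x hx ξ => (hell x hx ξ).1
  have hC : 0 ≤ C := by
    have := (sq_nonneg _).trans (hreg (1 / 2) (by norm_num) 0 (by norm_num) ⟨0, hd⟩ ⟨0, hd⟩)
    norm_num [abs_of_pos] at this
    linarith
  have hsol := h₁.isWeakFluxSolution_sub hT hDm
    (fun x hx => abs_apply_le_of_elliptic hc (hDsymm x hx) (hell x hx)) h₂ hinit
  have hH : Integrable (fun p : ℝ × (Fin d → ℝ) => (d : ℝ) ^ 2 * C / (4 * c) *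
      ((∑ j, g₁ p.1 p.2 j ^ 2) / (u₁ p.1 p.2 * (1 - u₁ p.1 p.2)) +
        (∑ j, g₂ p.1 p.2 j ^ 2) / (u₂ p.1 p.2 * (1 - u₂ p.1 p.2))) +
      |∑ i, (g₁ p.1 p.2 i - g₂ p.1 p.2 i) * (∑ j, D (u₁ p.1 p.2) i j * g₁ p.1 p.2 j -
        ∑ j, D (u₂ p.1 p.2) i j * g₂ p.1 p.2 j)|)
      ((volume.restrict (Ioc 0 T)).prod (volume.restrict (cubeR d))) := by
    have e₁ := h₁.2.2.2.2.2.2.2.1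
    have e₂ := h₂.2.2.2.2.2.2.2.1
    rw [IntegrableOn, restrict_QT_eq_prod] at e₁ e₂
    exact ((e₁.add e₂).const_mul _).add (integrable_finsetSum _ fun i _ =>
      (hsol.memLp_grad i).integrable_mul (hsol.memLp_flux i)).abs
  have hzero : ∀ t ∈ Ioc 0 T, ∀ᵐ θ ∂volume.restrict (cubeR d), u₁ t θ = u₂ t θ := by
    intro t ht
    filter_upwards [(hsol.mono ht.2).ae_eq_zero ht.1
      (hH.mono_measure (Measure.prod_mono
        (Measure.restrict_mono (Ioc_subset_Ioc_right ht.2) le_rfl) le_rfl))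
      fun p => neg_sum_mul_flux_sub_le_abs_mul hc hell' hC hreg (h₁.mem_Icc _ _)
        (h₂.mem_Icc _ _) _ _] with θ hθ
    exact sub_eq_zero.1 hθ
  rw [restrict_QT_eq_prod,
    Measure.ae_prod_iff_ae_ae (measurableSet_eq_fun h₁.measurable h₂.measurable)]
  filter_upwards [ae_restrict_mem measurableSet_Ioc] with t ht
  exact hzero t ht
end
end
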